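/- arXiv:2402.03065 — 5 statements merged into one kernel-verified Lean document; each statement's English description precedes it below -/
import Mathlib

section
/- Let T be a 2-tree on [n−1] and let x ∈ U. Then X(x)·M_T(x)ᵀ = 0 and the matrix M_T(x) has rank n−2; consequently the kernel of the linear map ℂⁿ → ℂ^{n−2}, v ↦ M_T(x)·v, equals the row span of the 2×n matrix X(x). -/
namespace MinKin

noncomputable section

attribute [local instance] Classical.propDecidable

open scoped BigOperators

/-- First row of the 2×n matrix X, at column `j` (1-based). -/
def colA (n j : ℕ) : ℂ := if j = n then 0 else 1

/-- Second row of X at column `j` (1-based): `(0,1,x_1,…,x_{n-3},1)`. -/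
def colB (n : ℕ) (x : Fin (n - 3) → ℂ) (j : ℕ) : ℂ :=
  if j = 1 then 0
  else if j = 2 then 1
  else if j = n then 1
  else if h : j - 3 < n - 3 then x ⟨j - 3, h⟩ else 0

/-- The Plücker coordinate `p_{ij}(x)`, the 2×2 minor of X on columns i and j. -/
def pc (n : ℕ) (x : Fin (n - 3) → ℂ) (i j : ℕ) : ℂ :=
  colA n i * colB n x j - colA n j * colB n x i

/-- The partial derivative `∂p_{ij}/∂x_m` (with `m : Fin (n-3)` zero-based, so that
the variable `x m` appears in column `(m:ℕ)+3` of X). -/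
def dpc (n : ℕ) (i j : ℕ) (m : Fin (n - 3)) : ℂ :=
  colA n i * (if j = (m : ℕ) + 3 then (1 : ℂ) else 0)
    - colA n j * (if i = (m : ℕ) + 3 then (1 : ℂ) else 0)

/-- The index set `S = {(i,j) : 1 ≤ i < j ≤ n-1, (i,j) ≠ (1,2)}`. -/
def Sfin (n : ℕ) : Finset (ℕ × ℕ) :=
  ((Finset.Icc 1 (n - 1)) ×ˢ (Finset.Icc 1 (n - 1))).filter
    (fun e => e.1 < e.2 ∧ e ≠ (1, 2))

/-- The domain `U = {x : p_{ij}(x) ≠ 0 for all (i,j) ∈ S}`. -/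
def Udom (n : ℕ) : Set (Fin (n - 3) → ℂ) :=
  {x | ∀ e ∈ Sfin n, pc n x e.1 e.2 ≠ 0}

/-- `x` is a critical point of `L_{T₀} = Σ_{e ∈ T₀} s_e · log p_e`. -/
def IsCrit (n : ℕ) (T₀ : Finset (ℕ × ℕ)) (s : ℕ × ℕ → ℂ) (x : Fin (n - 3) → ℂ) : Prop :=
  ∀ m : Fin (n - 3), ∑ e ∈ T₀, s e * dpc n e.1 e.2 m / pc n x e.1 e.2 = 0

/-- Edge sets built inductively from the parent choices `par`. -/
def edgesUpTo (par : ℕ → ℕ × ℕ) : ℕ → Finset (ℕ × ℕ)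
  | 0 => {(1, 2)}
  | k + 1 =>
      if k + 1 < 3 then {(1, 2)}
      else edgesUpTo par k ∪ {((par (k + 1)).1, k + 1), ((par (k + 1)).2, k + 1)}

/-- A 2-tree on `[n-1]`: for each `k = 3,…,n-1` an already-present edge
`par k = (i_k, j_k)` with `i_k < j_k ≤ k-1` is chosen, and the edges
`(i_k, k)` and `(j_k, k)` are added. -/
structure TwoTree (n : ℕ) : Type where
  par : ℕ → ℕ × ℕ
  lt : ∀ k, 3 ≤ k → k ≤ n - 1 → (par k).1 < (par k).2 ∧ (par k).2 < k
  mem : ∀ k, 3 ≤ k → k ≤ n - 1 → par k ∈ edgesUpTo par (k - 1)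

/-- The edge set of a 2-tree. -/
def TwoTree.edges {n : ℕ} (T : TwoTree n) : Finset (ℕ × ℕ) := edgesUpTo T.par (n - 1)

/-- A finite edge set is a 2-tree on `[n-1]`. -/
def IsTwoTree (n : ℕ) (E : Finset (ℕ × ℕ)) : Prop := ∃ T : TwoTree n, T.edges = E

/-- `c` is a child of `e` in the 2-tree `T`. -/
def Child (n : ℕ) (T : TwoTree n) (e c : ℕ × ℕ) : Prop :=
  ∃ k, 3 ≤ k ∧ k ≤ n - 1 ∧ T.par k = e ∧ (c = (e.1, k) ∨ c = (e.2, k))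

/-- The set `dec(e)` of descendants of the edge `e` (including `e` itself). -/
def dec (n : ℕ) (T : TwoTree n) (e : ℕ × ℕ) : Finset (ℕ × ℕ) :=
  T.edges.filter (fun f => Relation.ReflTransGen (Child n T) e f)

/-- The bracket `[s_e] = Σ_{f ∈ dec(e)} s_f`. -/
def brk (n : ℕ) (T : TwoTree n) (s : ℕ × ℕ → ℂ) (e : ℕ × ℕ) : ℂ :=
  ∑ f ∈ dec n T e, s f

/-- The Mandelstam invariants `s` are generic for `T`. -/
def Generic (n : ℕ) (T : TwoTree n) (s : ℕ × ℕ → ℂ) : Prop :=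
  ∀ k, 3 ≤ k → k ≤ n - 1 →
    brk n T s ((T.par k).1, k) ≠ 0 ∧ brk n T s ((T.par k).2, k) ≠ 0 ∧
      brk n T s ((T.par k).1, k) + brk n T s ((T.par k).2, k) ≠ 0

/-- `a_e = |dec(e)|`. -/
def aA (n : ℕ) (T : TwoTree n) (e : ℕ × ℕ) : ℕ := (dec n T e).card

/-- `v_T(e)`: the number of triangles of `T` containing the edge `e`. -/
def vT (n : ℕ) (T : TwoTree n) (e : ℕ × ℕ) : ℕ :=
  ((Finset.Icc 3 (n - 1)).filter
    (fun k => e = T.par k ∨ e = ((T.par k).1, k) ∨ e = ((T.par k).2, k))).card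

/-- The Horn product `P_e(s)`: over all ancestral triangles `{i,j,k}` of `e`, the
factor `[s_c]/([s_{(i,k)}]+[s_{(j,k)}])` where `c` is the child containing `e`
among its descendants. -/
def hornP (n : ℕ) (T : TwoTree n) (s : ℕ × ℕ → ℂ) (e : ℕ × ℕ) : ℂ :=
  ∏ k ∈ Finset.Icc 3 (n - 1),
    (if e ∈ dec n T ((T.par k).1, k) then
        brk n T s ((T.par k).1, k)
          / (brk n T s ((T.par k).1, k) + brk n T s ((T.par k).2, k))
      else if e ∈ dec n T ((T.par k).2, k) then
        brk n T s ((T.par k).2, k)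
          / (brk n T s ((T.par k).1, k) + brk n T s ((T.par k).2, k))
      else 1)

/-- Auxiliary recursion for the signs `ε_e`. -/
def epsAux (par : ℕ → ℕ × ℕ) : ℕ → ℕ × ℕ → ℂ
  | 0, _ => 1
  | k + 1, e =>
      if e = (1, 2) then 1
      else if e = ((par (k + 1)).1, k + 1) then epsAux par k (par (k + 1))
      else if e = ((par (k + 1)).2, k + 1) then -(epsAux par k (par (k + 1)))
      else epsAux par k e

/-- The sign `ε_e ∈ {1,-1}`: `ε_{(1,2)} = 1`, `ε_{(i,k)} = ε_{(i,j)}`,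
`ε_{(j,k)} = -ε_{(i,j)}` for each triangle `{i,j,k}`. -/
def eps (n : ℕ) (T : TwoTree n) (e : ℕ × ℕ) : ℂ := epsAux T.par (n - 1) e

/-- The negated Hessian matrix `𝓗(x) = -Hess(L_{T₀})(x)`. -/
def negHess (n : ℕ) (T₀ : Finset (ℕ × ℕ)) (s : ℕ × ℕ → ℂ) (x : Fin (n - 3) → ℂ) :
    Matrix (Fin (n - 3)) (Fin (n - 3)) ℂ :=
  Matrix.of fun (l m : Fin (n - 3)) =>
    ∑ e ∈ T₀, s e * dpc n e.1 e.2 l * dpc n e.1 e.2 m / pc n x e.1 e.2 ^ 2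

/-- The on-shell diagram of `T`: the triangles of `T` together with `(1,2,n)`. -/
def triples (n : ℕ) (T : TwoTree n) : Finset (ℕ × ℕ × ℕ) :=
  insert (1, 2, n) ((Finset.Icc 3 (n - 1)).image fun k => ((T.par k).1, (T.par k).2, k))

/-- The edge `e` is contained in the triple `t`. -/
def inTriple (e : ℕ × ℕ) (t : ℕ × ℕ × ℕ) : Prop :=
  e = (t.1, t.2.1) ∨ e = (t.1, t.2.2) ∨ e = (t.2.1, t.2.2)

/-- `ṽ(e)`: the number of triples of the on-shell diagram containing `e`. -/
def vTil (n : ℕ) (T : TwoTree n) (e : ℕ × ℕ) : ℕ :=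
  ((triples n T).filter (inTriple e)).card

/-- The edges contained in at least one triple of the on-shell diagram. -/
def diagEdges (n : ℕ) (T : TwoTree n) : Finset (ℕ × ℕ) :=
  (triples n T).biUnion fun t => {(t.1, t.2.1), (t.1, t.2.2), (t.2.1, t.2.2)}

/-- The CHY integrand `I_T(x) = Π_e p_e(x)^{ṽ(e)-2}`. -/
def integrand (n : ℕ) (T : TwoTree n) (x : Fin (n - 3) → ℂ) : ℂ :=
  ∏ e ∈ diagEdges n T, pc n x e.1 e.2 ^ ((vTil n T e : ℤ) - 2)

/-- The Horn matrix `H_T`: rows come in consecutive triples indexed by the triangles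
(in order k = 3,…,n-1), columns indexed by the non-initial edges of `T`
(in order (i_3,3),(j_3,3),(i_4,4),(j_4,4),…). -/
def HornMat (n : ℕ) (T : TwoTree n) : Matrix (Fin (3 * n - 9)) (Fin (2 * n - 6)) ℤ :=
  Matrix.of fun (ρ : Fin (3 * n - 9)) (c : Fin (2 * n - 6)) =>
    let k := (ρ : ℕ) / 3 + 3
    let c1 : ℕ × ℕ := ((T.par k).1, k)
    let c2 : ℕ × ℕ := ((T.par k).2, k)
    let kc := (c : ℕ) / 2 + 3
    let e : ℕ × ℕ := if (c : ℕ) % 2 = 0 then ((T.par kc).1, kc) else ((T.par kc).2, kc)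
    if (ρ : ℕ) % 3 = 0 then (if e ∈ dec n T c1 then 1 else 0)
    else if (ρ : ℕ) % 3 = 1 then (if e ∈ dec n T c2 then 1 else 0)
    else (if e ∈ dec n T c1 ∨ e ∈ dec n T c2 then -1 else 0)

/-- The matrix `A` whose r-th row has 1 in columns 3r-2, 3r-1, 3r (1-based). -/
def Amat (n : ℕ) : Matrix (Fin (n - 3)) (Fin (3 * n - 9)) ℤ :=
  Matrix.of fun (r : Fin (n - 3)) (c : Fin (3 * n - 9)) =>
    if (c : ℕ) / 3 = (r : ℕ) then 1 else 0

/-- Polynomial version of the first row of X. -/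
def colAP (n : ℕ) (j : ℕ) : MvPolynomial (Fin (n - 3)) ℂ := if j = n then 0 else 1

/-- Polynomial version of the second row of X. -/
def colBP (n : ℕ) (j : ℕ) : MvPolynomial (Fin (n - 3)) ℂ :=
  if j = 1 then 0
  else if j = 2 then 1
  else if j = n then 1
  else if h : j - 3 < n - 3 then MvPolynomial.X ⟨j - 3, h⟩ else 0

/-- The Plücker coordinate `p_{ij}` as a polynomial in `ℂ[x_1,…,x_{n-3}]`. -/
def pcP (n : ℕ) (i j : ℕ) : MvPolynomial (Fin (n - 3)) ℂ :=
  colAP n i * colBP n j - colAP n j * colBP n i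

/-- The r-th triple (0-based row index) of the on-shell diagram of `T`. -/
def tripleOf (n : ℕ) (T : TwoTree n) (r : ℕ) : ℕ × ℕ × ℕ :=
  if r + 3 ≤ n - 1 then ((T.par (r + 3)).1, (T.par (r + 3)).2, r + 3) else (1, 2, n)

/-- The matrix `M_T` over `ℂ[x_1,…,x_{n-3}]`, whose row indexed by a triple
`{i,j,k}` (i<j<k) is `p_{jk}·e_i - p_{ik}·e_j + p_{ij}·e_k`. -/
def Mmat (n : ℕ) (T : TwoTree n) :
    Matrix (Fin (n - 2)) (Fin n) (MvPolynomial (Fin (n - 3)) ℂ) :=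
  Matrix.of fun (r : Fin (n - 2)) (c : Fin n) =>
    if (c : ℕ) + 1 = (tripleOf n T r).1 then
      pcP n (tripleOf n T r).2.1 (tripleOf n T r).2.2
    else if (c : ℕ) + 1 = (tripleOf n T r).2.1 then
      -pcP n (tripleOf n T r).1 (tripleOf n T r).2.2
    else if (c : ℕ) + 1 = (tripleOf n T r).2.2 then
      pcP n (tripleOf n T r).1 (tripleOf n T r).2.1
    else 0

/-- The matrix `M_T` evaluated at a point `x ∈ ℂ^{n-3}`. -/
def MmatC (n : ℕ) (T : TwoTree n) (x : Fin (n - 3) → ℂ) : Matrix (Fin (n - 2)) (Fin n) ℂ :=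
  Matrix.of fun (r : Fin (n - 2)) (c : Fin n) =>
    if (c : ℕ) + 1 = (tripleOf n T r).1 then
      pc n x (tripleOf n T r).2.1 (tripleOf n T r).2.2
    else if (c : ℕ) + 1 = (tripleOf n T r).2.1 then
      -pc n x (tripleOf n T r).1 (tripleOf n T r).2.2
    else if (c : ℕ) + 1 = (tripleOf n T r).2.2 then
      pc n x (tripleOf n T r).1 (tripleOf n T r).2.1
    else 0

/-- The 2×n matrix X evaluated at `x`. -/
def Xmat (n : ℕ) (x : Fin (n - 3) → ℂ) : Matrix (Fin 2) (Fin n) ℂ :=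
  Matrix.of fun (r : Fin 2) (c : Fin n) =>
    if r = 0 then colA n ((c : ℕ) + 1) else colB n x ((c : ℕ) + 1)

/-- The monotone embedding `Fin (n-2) → Fin n` skipping the (0-based) positions
`a < b`. -/
def delCols (n a b : ℕ) (d : Fin (n - 2)) : Fin n :=
  ⟨if (d : ℕ) < a then (d : ℕ) else if (d : ℕ) + 1 < b then (d : ℕ) + 1 else (d : ℕ) + 2, by
    have := d.isLt; split_ifs <;> omega⟩

/-- The maximal minor of `M_T` obtained by deleting columns `i < j` (1-based). -/
def maxMinor (n : ℕ) (T : TwoTree n) (i j : ℕ) : MvPolynomial (Fin (n - 3)) ℂ :=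
  Matrix.det (Matrix.of fun (r d : Fin (n - 2)) => Mmat n T r (delCols n (i - 1) (j - 1) d))

/-- `Δ_T = Π_e p_e^{ṽ(e)-1}`. -/
def DeltaT (n : ℕ) (T : TwoTree n) : MvPolynomial (Fin (n - 3)) ℂ :=
  ∏ e ∈ diagEdges n T, pcP n e.1 e.2 ^ (vTil n T e - 1)

/-- `T₀` has, for generic coefficients, exactly one critical point in `U`. -/
def UniqueCritGeneric (n : ℕ) (T₀ : Finset (ℕ × ℕ)) : Prop :=
  ∃ g : MvPolynomial {e : ℕ × ℕ // e ∈ T₀} ℂ, g ≠ 0 ∧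
    ∀ s : ℕ × ℕ → ℂ, MvPolynomial.eval (fun v => s v.1) g ≠ 0 →
      ∃! x : Fin (n - 3) → ℂ, x ∈ Udom n ∧ IsCrit n T₀ s x

/-- `T₀ ⊆ S` exhibits minimal kinematics. -/
def ExhibitsMinKin (n : ℕ) (T₀ : Finset (ℕ × ℕ)) : Prop :=
  T₀ ⊆ Sfin n ∧ UniqueCritGeneric n T₀ ∧
    ∀ T₁ : Finset (ℕ × ℕ), T₁ ⊆ Sfin n → T₀ ⊆ T₁ → UniqueCritGeneric n T₁ → T₁ = T₀
/-- The entry of `v` in the 1-based position `m`. -/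
def oneBased {n : ℕ} (v : Fin n → ℂ) (m : ℕ) : ℂ :=
  if h : m - 1 < n then v ⟨m - 1, h⟩ else 0

lemma oneBased_succ {n : ℕ} (v : Fin n → ℂ) (c : Fin n) : oneBased v (c + 1) = v c := by
  simp [oneBased]

lemma sum_ite_add_one_eq {n : ℕ} (v : Fin n → ℂ) (a : ℂ) {m : ℕ} (h₁ : 1 ≤ m) (h₂ : m ≤ n) :
    ∑ c : Fin n, (if (c : ℕ) + 1 = m then a else 0) * v c = a * oneBased v m := by
  have hm : m - 1 < n := by omega
  rw [Finset.sum_eq_single (⟨m - 1, hm⟩ : Fin n)]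
  · rw [if_pos (by simp only; omega), oneBased, dif_pos hm]
  · intro c _ hc
    rw [if_neg, zero_mul]
    intro h
    exact hc (Fin.ext (by simp only; omega))
  · simp

lemma one_le_of_mem_edgesUpTo {n : ℕ} (T : TwoTree n) {k : ℕ} (hk : k ≤ n - 1) {e : ℕ × ℕ}
    (he : e ∈ edgesUpTo T.par k) : 1 ≤ e.1 ∧ 1 ≤ e.2 := by
  induction k generalizing e with
  | zero =>
    simp only [edgesUpTo, Finset.mem_singleton] at he
    simp [he]
  | succ k ih =>
    rw [edgesUpTo] at he
    split_ifs at he with h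
    · simp only [Finset.mem_singleton] at he
      simp [he]
    · have hp := ih (by omega) (T.mem (k + 1) (by omega) hk)
      simp only [Finset.mem_union, Finset.mem_insert, Finset.mem_singleton] at he
      rcases he with he | rfl | rfl
      · exact ih (by omega) he
      · exact ⟨hp.1, by simp⟩
      · exact ⟨hp.2, by simp⟩

lemma tripleOf_bounds {n : ℕ} (hn : 4 ≤ n) (T : TwoTree n) (r : ℕ) :
    1 ≤ (tripleOf n T r).1 ∧ (tripleOf n T r).1 < (tripleOf n T r).2.1 ∧
      (tripleOf n T r).2.1 < (tripleOf n T r).2.2 ∧ (tripleOf n T r).2.1 ≤ n - 1 ∧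
        (tripleOf n T r).2.2 ≤ n := by
  unfold tripleOf
  split_ifs with h
  · have hlt := T.lt (r + 3) (by omega) h
    have hpos := one_le_of_mem_edgesUpTo T (by omega) (T.mem (r + 3) (by omega) h)
    exact ⟨hpos.1, hlt.1, hlt.2, by simp only; omega, by simp only; omega⟩
  · exact ⟨le_rfl, by simp, by simp only; omega, by simp only; omega, le_rfl⟩

lemma exists_tripleOf_eq {n : ℕ} (hn : 4 ≤ n) (T : TwoTree n) {m : ℕ} (h₁ : 3 ≤ m) (h₂ : m ≤ n) :
    ∃ r : Fin (n - 2), (tripleOf n T r).2.2 = m := by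
  refine ⟨⟨m - 3, by omega⟩, ?_⟩
  unfold tripleOf
  split_ifs with h <;> simp only at h ⊢ <;> omega

lemma pc_ne_zero {n : ℕ} {x : Fin (n - 3) → ℂ} (hx : x ∈ Udom n) {i j : ℕ} (hi : 1 ≤ i)
    (hij : i < j) (hj : j ≤ n - 1) : pc n x i j ≠ 0 := by
  by_cases h : (i, j) = (1, 2)
  · obtain ⟨rfl, rfl⟩ := Prod.mk.inj h
    have h₁ : 1 ≠ n := by omega
    simp [pc, colA, colB, h₁]
  · refine hx (i, j) ?_
    simp only [Sfin, Finset.mem_filter, Finset.mem_product, Finset.mem_Icc]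
    exact ⟨⟨⟨hi, by omega⟩, by omega, hj⟩, hij, h⟩

lemma MmatC_mulVec_apply {n : ℕ} (hn : 4 ≤ n) (T : TwoTree n) (x : Fin (n - 3) → ℂ)
    (v : Fin n → ℂ) (r : Fin (n - 2)) :
    (MmatC n T x).mulVec v r =
      pc n x (tripleOf n T r).2.1 (tripleOf n T r).2.2 * oneBased v (tripleOf n T r).1
        - pc n x (tripleOf n T r).1 (tripleOf n T r).2.2 * oneBased v (tripleOf n T r).2.1
        + pc n x (tripleOf n T r).1 (tripleOf n T r).2.1 * oneBased v (tripleOf n T r).2.2 := by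
  obtain ⟨h₁, h₂, h₃, -, h₅⟩ := tripleOf_bounds hn T r
  rw [Matrix.mulVec, dotProduct, sub_eq_add_neg, ← neg_mul, ← sum_ite_add_one_eq v _ h₁ (by omega),
    ← sum_ite_add_one_eq v _ (by omega : 1 ≤ (tripleOf n T r).2.1) (by omega),
    ← sum_ite_add_one_eq v _ (by omega : 1 ≤ (tripleOf n T r).2.2) h₅,
    ← Finset.sum_add_distrib, ← Finset.sum_add_distrib]
  refine Finset.sum_congr rfl fun c _ => ?_
  simp only [MmatC, Matrix.of_apply]
  split_ifs <;> first | omega | ring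

lemma oneBased_Xmat_zero {n : ℕ} (x : Fin (n - 3) → ℂ) {m : ℕ} (h₁ : 1 ≤ m) (h₂ : m ≤ n) :
    oneBased (Xmat n x 0) m = colA n m := by
  have hm : m - 1 < n := by omega
  simp [oneBased, hm, Xmat, Nat.sub_add_cancel h₁]

lemma oneBased_Xmat_one {n : ℕ} (x : Fin (n - 3) → ℂ) {m : ℕ} (h₁ : 1 ≤ m) (h₂ : m ≤ n) :
    oneBased (Xmat n x 1) m = colB n x m := by
  have hm : m - 1 < n := by omega
  simp [oneBased, hm, Xmat, Nat.sub_add_cancel h₁]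

lemma Xmat_mul_MmatC_transpose {n : ℕ} (hn : 4 ≤ n) (T : TwoTree n) (x : Fin (n - 3) → ℂ) :
    Xmat n x * (MmatC n T x).transpose = 0 := by
  ext a r
  obtain ⟨h₁, h₂, h₃, -, h₅⟩ := tripleOf_bounds hn T r
  have h : (Xmat n x * (MmatC n T x).transpose) a r = (MmatC n T x).mulVec (Xmat n x a) r := by
    simp only [Matrix.mul_apply, Matrix.transpose_apply, Matrix.mulVec, dotProduct, mul_comm]
  rw [h, MmatC_mulVec_apply hn]
  fin_cases a
  · simp only [Fin.zero_eta, Matrix.zero_apply]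
    rw [oneBased_Xmat_zero x h₁ (by omega), oneBased_Xmat_zero x (by omega) (by omega),
      oneBased_Xmat_zero x (by omega) h₅]
    simp only [pc]
    ring
  · simp only [Fin.mk_one, Matrix.zero_apply]
    rw [oneBased_Xmat_one x h₁ (by omega), oneBased_Xmat_one x (by omega) (by omega),
      oneBased_Xmat_one x (by omega) h₅]
    simp only [pc]
    ring

lemma oneBased_eq_of_MmatC_mulVec_eq_zero {n : ℕ} (hn : 4 ≤ n) (T : TwoTree n)
    {x : Fin (n - 3) → ℂ} (hx : x ∈ Udom n) {v : Fin n → ℂ}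
    (hv : (MmatC n T x).mulVec v = 0) {m : ℕ} (h₁ : 1 ≤ m) (h₂ : m ≤ n) :
    oneBased v m =
      oneBased v 1 * colA n m + (oneBased v 2 - oneBased v 1) * colB n x m := by
  induction m using Nat.strong_induction_on with
  | _ m ih =>
    rcases (by omega : m = 1 ∨ m = 2 ∨ 3 ≤ m) with rfl | rfl | h₃
    · have hne : 1 ≠ n := by omega
      simp [colA, colB, hne]
    · have hne : 2 ≠ n := by omega
      simp [colA, colB, hne]
    · obtain ⟨r, rfl⟩ := exists_tripleOf_eq hn T h₃ h₂
      obtain ⟨hi, hij, hjk, hj, -⟩ := tripleOf_bounds hn T r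
      have hr := congrFun hv r
      rw [MmatC_mulVec_apply hn, ih _ (by omega) hi (by omega),
        ih _ hjk (by omega) (by omega), Pi.zero_apply] at hr
      refine mul_left_cancel₀ (pc_ne_zero hx hi hij hj) ?_
      rw [← sub_eq_zero, ← hr]
      simp only [pc]
      ring

lemma vecMul_Xmat_apply {n : ℕ} (x : Fin (n - 3) → ℂ) (w : Fin 2 → ℂ) (c : Fin n) :
    Matrix.vecMul w (Xmat n x) c = w 0 * colA n (c + 1) + w 1 * colB n x (c + 1) := by
  simp [Matrix.vecMul, dotProduct, Fin.sum_univ_two, Xmat]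

lemma MmatC_mulVec_eq_zero_iff {n : ℕ} (hn : 4 ≤ n) (T : TwoTree n)
    {x : Fin (n - 3) → ℂ} (hx : x ∈ Udom n) (v : Fin n → ℂ) :
    (MmatC n T x).mulVec v = 0 ↔ ∃ w : Fin 2 → ℂ, v = Matrix.vecMul w (Xmat n x) := by
  constructor
  · intro hv
    refine ⟨![oneBased v 1, oneBased v 2 - oneBased v 1], funext fun c => ?_⟩
    rw [vecMul_Xmat_apply, ← oneBased_succ v c,
      oneBased_eq_of_MmatC_mulVec_eq_zero hn T hx hv (by omega) (by omega)]
    simp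
  · rintro ⟨w, rfl⟩
    rw [← Matrix.vecMul_transpose, Matrix.vecMul_vecMul, Xmat_mul_MmatC_transpose hn,
      Matrix.vecMul_zero]

lemma vecMul_Xmat_injective {n : ℕ} (hn : 4 ≤ n) (x : Fin (n - 3) → ℂ) :
    Function.Injective (Xmat n x).vecMulLinear := by
  rw [← LinearMap.ker_eq_bot, LinearMap.ker_eq_bot']
  intro w hw
  have hne₁ : 1 ≠ n := by omega
  have hne₂ : 2 ≠ n := by omega
  have h₁ := congrFun hw ⟨0, by omega⟩
  have h₂ := congrFun hw ⟨1, by omega⟩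
  rw [Matrix.vecMulLinear_apply, vecMul_Xmat_apply] at h₁ h₂
  simp only [colA, colB, zero_add, Nat.reduceAdd, hne₁, hne₂, if_true, if_false, mul_one, mul_zero,
    add_zero, OfNat.ofNat_ne_one, Pi.zero_apply] at h₁ h₂
  rw [h₁, zero_add] at h₂
  ext a
  fin_cases a
  · exact h₁
  · exact h₂

lemma rank_MmatC {n : ℕ} (hn : 4 ≤ n) (T : TwoTree n) {x : Fin (n - 3) → ℂ}
    (hx : x ∈ Udom n) : (MmatC n T x).rank = n - 2 := by
  have hker : LinearMap.ker (MmatC n T x).mulVecLin =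
      LinearMap.range (Xmat n x).vecMulLinear := by
    ext v
    rw [LinearMap.mem_ker, Matrix.mulVecLin_apply, MmatC_mulVec_eq_zero_iff hn T hx]
    simp only [LinearMap.mem_range, Matrix.vecMulLinear_apply, eq_comm]
  have h := LinearMap.finrank_range_add_finrank_ker (MmatC n T x).mulVecLin
  rw [hker, LinearMap.finrank_range_of_inj (vecMul_Xmat_injective hn x),
    Module.finrank_fin_fun, Module.finrank_fin_fun] at h
  rw [Matrix.rank]
  omega

/-- X(x)·M_T(x)ᵀ = 0, M_T(x) has rank n-2, and the kernel of
v ↦ M_T(x)·v equals the row span of X(x). -/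
theorem kernel_of_Mmat (n : ℕ) (hn : 4 ≤ n) (T : TwoTree n)
    (x : Fin (n - 3) → ℂ) (hx : x ∈ Udom n) :
    Xmat n x * (MmatC n T x).transpose = 0 ∧
      (MmatC n T x).rank = n - 2 ∧
      ∀ v : Fin n → ℂ,
        Matrix.mulVec (MmatC n T x) v = 0 ↔
          ∃ w : Fin 2 → ℂ, v = Matrix.vecMul w (Xmat n x) := by
  exact ⟨Xmat_mul_MmatC_transpose hn T x, rank_MmatC hn T hx, MmatC_mulVec_eq_zero_iff hn T hx⟩

end
end MinKin
end

section
/- Let T be a 2-tree on [n−1] and let Δ(M_T) ∈ ℂ[x_1,…,x_{n−3}] be a greatest common divisor of the maximal minors of M_T. Then, in the field of rational functions ℂ(x_1,…,x_{n−3}), Δ(M_T)² / Π_{triples {i,j,k} of the on-shell diagram} ( p_{ij}·p_{ik}·p_{jk} ) = c · Π_e p_{ij}^{ṽ(e)−2} for some nonzero constant c, where the last product runs over all edges e = {i,j} contained in at least one triple of the on-shell diagram of T. -/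
namespace MinKin

noncomputable section

attribute [local instance] Classical.propDecidable

open scoped BigOperators

section Plucker

variable {n : ℕ}

lemma pcP_one_two (hn : 4 ≤ n) : pcP n 1 2 = 1 := by
  have h1 : 1 ≠ n := by omega
  have h2 : 2 ≠ n := by omega
  simp [pcP, colAP, colBP, h1, h2]

lemma pcP_ne_zero (hn : 4 ≤ n) {i j : ℕ} (hi : 1 ≤ i) (hij : i < j) (hj : j ≤ n) :
    pcP n i j ≠ 0 := by
  have hin : i ≠ n := by omega
  have hj1 : j ≠ 1 := by omega
  have hn1 : n ≠ 1 := by omega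
  have hn2 : n ≠ 2 := by omega
  obtain rfl | hjn := eq_or_ne j n
  · simp [pcP, colAP, colBP, hin, hn1]
  have hvar : j ≠ 2 → j - 3 < n - 3 := by omega
  have hvar' : i ≠ 1 → i ≠ 2 → i - 3 < n - 3 := by omega
  rw [pcP, colAP, colAP, if_neg hin, if_neg hjn, one_mul, one_mul, sub_ne_zero]
  intro h
  by_cases hj2 : j = 2
  · have : i = 1 := by omega
    simp [colBP, this, hj2] at h
  by_cases hi1 : i = 1
  · simp [colBP, hi1, hj1, hj2, hjn, hvar hj2] at h
  by_cases hi2 : i = 2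
  · have := congrArg MvPolynomial.totalDegree h
    simp [colBP, hi2, hj1, hj2, hjn, hvar hj2] at this
  · simp [colBP, hi1, hi2, hin, hj1, hj2, hjn, hvar hj2, hvar' hi1 hi2] at h
    omega

lemma pcP_colAP_relation (i j k : ℕ) :
    pcP n j k * colAP n i - pcP n i k * colAP n j + pcP n i j * colAP n k = 0 := by
  simp only [pcP]; ring

lemma pcP_colBP_relation (i j k : ℕ) :
    pcP n j k * colBP n i - pcP n i k * colBP n j + pcP n i j * colBP n k = 0 := by
  simp only [pcP]; ring

end Plucker

section Diagram

variable {n : ℕ} (T : TwoTree n)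

lemma mem_edgesUpTo {par : ℕ → ℕ × ℕ} {m : ℕ} {e : ℕ × ℕ} (he : e ∈ edgesUpTo par m) :
    e = (1, 2) ∨ ∃ k, 3 ≤ k ∧ k ≤ m ∧ (e = ((par k).1, k) ∨ e = ((par k).2, k)) := by
  induction m with
  | zero => exact Or.inl (by simpa [edgesUpTo] using he)
  | succ m ih =>
    rw [edgesUpTo] at he
    split_ifs at he with hm
    · exact Or.inl (by simpa using he)
    · rw [Finset.mem_union, Finset.mem_insert, Finset.mem_singleton] at he
      rcases he with he | he
      · rcases ih he with h | ⟨k, h3, hk, h⟩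
        · exact Or.inl h
        · exact Or.inr ⟨k, h3, by omega, h⟩
      · exact Or.inr ⟨m + 1, by omega, le_rfl, he⟩

lemma one_le_par_fst (k : ℕ) (h3 : 3 ≤ k) (hk : k ≤ n - 1) : 1 ≤ (T.par k).1 := by
  induction k using Nat.strong_induction_on with
  | _ k ih =>
    rcases mem_edgesUpTo (T.mem k h3 hk) with h | ⟨m, hm3, hmk, h | h⟩
    · simp [h]
    · rw [h]; exact ih m (by omega) hm3 (by omega)
    · rw [h]
      have := ih m (by omega) hm3 (by omega)
      have := (T.lt m hm3 (by omega)).1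
      simp only
      omega

lemma tripleOf_last (hn : 4 ≤ n) {r : ℕ} (hr : r < n - 2) : (tripleOf n T r).2.2 = r + 3 := by
  unfold tripleOf
  split_ifs
  · rfl
  · simp only; omega

lemma tripleOf_lt (hn : 4 ≤ n) (r : ℕ) :
    1 ≤ (tripleOf n T r).1 ∧ (tripleOf n T r).1 < (tripleOf n T r).2.1 ∧
      (tripleOf n T r).2.1 < (tripleOf n T r).2.2 ∧ (tripleOf n T r).2.2 ≤ n := by
  unfold tripleOf
  split_ifs with h
  · have := T.lt (r + 3) (by omega) h
    exact ⟨one_le_par_fst T _ (by omega) h, this.1, this.2, by simp only; omega⟩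
  · simp only; omega

/-- The first edge of a triple is `(1, 2)` or was added by an earlier triple. -/
lemma tripleOf_base (r : ℕ) :
    ((tripleOf n T r).1, (tripleOf n T r).2.1) = (1, 2) ∨ ∃ s < n - 2,
      ((tripleOf n T r).1, (tripleOf n T r).2.1) = ((tripleOf n T s).1, (tripleOf n T s).2.2) ∨
      ((tripleOf n T r).1, (tripleOf n T r).2.1) =
        ((tripleOf n T s).2.1, (tripleOf n T s).2.2) := by
  by_cases h : r + 3 ≤ n - 1
  · have hr : ((tripleOf n T r).1, (tripleOf n T r).2.1) = T.par (r + 3) := by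
      simp [tripleOf, h]
    rw [hr]
    refine (mem_edgesUpTo (T.mem (r + 3) (by omega) h)).imp_right ?_
    rintro ⟨k, h3, hk, he⟩
    obtain ⟨s, rfl⟩ := Nat.exists_eq_add_of_le' h3
    refine ⟨s, by omega, ?_⟩
    have hs : s + 3 ≤ n - 1 := by omega
    simpa [tripleOf, hs] using he
  · simp [tripleOf, h]

lemma triples_eq_image (hn : 4 ≤ n) :
    triples n T = (Finset.range (n - 2)).image (tripleOf n T) := by
  ext t
  simp only [triples, Finset.mem_insert, Finset.mem_image, Finset.mem_Icc, Finset.mem_range]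
  constructor
  · rintro (rfl | ⟨k, ⟨h3, hk⟩, rfl⟩)
    · exact ⟨n - 3, by omega, by rw [tripleOf, if_neg (by omega)]⟩
    · obtain ⟨s, rfl⟩ := Nat.exists_eq_add_of_le' h3
      exact ⟨s, by omega, by rw [tripleOf, if_pos hk]⟩
  · rintro ⟨r, hr, rfl⟩
    by_cases h : r + 3 ≤ n - 1
    · exact Or.inr ⟨r + 3, ⟨by omega, h⟩, by rw [tripleOf, if_pos h]⟩
    · exact Or.inl (by rw [tripleOf, if_neg h])

lemma prod_triples {M : Type*} [CommMonoid M] (hn : 4 ≤ n) (g : ℕ × ℕ × ℕ → M) :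
    ∏ t ∈ triples n T, g t = ∏ r ∈ Finset.range (n - 2), g (tripleOf n T r) := by
  rw [triples_eq_image T hn, Finset.prod_image]
  intro r hr s hs h
  have hr' := tripleOf_last T hn (Finset.mem_range.1 hr)
  have hs' := tripleOf_last T hn (Finset.mem_range.1 hs)
  rw [h] at hr'
  omega

lemma lt_of_mem_triples (hn : 4 ≤ n) {t : ℕ × ℕ × ℕ} (ht : t ∈ triples n T) :
    1 ≤ t.1 ∧ t.1 < t.2.1 ∧ t.2.1 < t.2.2 ∧ t.2.2 ≤ n := by
  rw [triples_eq_image T hn, Finset.mem_image] at ht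
  obtain ⟨r, -, rfl⟩ := ht
  exact tripleOf_lt T hn r

lemma lt_of_mem_diagEdges (hn : 4 ≤ n) {e : ℕ × ℕ} (he : e ∈ diagEdges n T) :
    1 ≤ e.1 ∧ e.1 < e.2 ∧ e.2 ≤ n := by
  simp only [diagEdges, Finset.mem_biUnion, Finset.mem_insert, Finset.mem_singleton] at he
  obtain ⟨t, ht, he⟩ := he
  have := lt_of_mem_triples T hn ht
  rcases he with rfl | rfl | rfl <;> simp only <;> omega

lemma diagEdges_eq (hn : 4 ≤ n) :
    diagEdges n T = insert (1, 2) ((Finset.range (n - 2)).biUnion fun r =>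
      {((tripleOf n T r).1, (tripleOf n T r).2.2),
        ((tripleOf n T r).2.1, (tripleOf n T r).2.2)}) := by
  ext e
  simp only [diagEdges, triples_eq_image T hn, Finset.mem_biUnion, Finset.mem_image,
    Finset.mem_range, Finset.mem_insert, Finset.mem_singleton]
  constructor
  · rintro ⟨_, ⟨r, hr, rfl⟩, rfl | h⟩
    · exact tripleOf_base T r
    · exact Or.inr ⟨r, hr, h⟩
  · rintro (rfl | ⟨r, hr, h⟩)
    · exact ⟨_, ⟨n - 3, by omega, rfl⟩, Or.inl (by rw [tripleOf, if_neg (by omega)])⟩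
    · exact ⟨_, ⟨r, hr, rfl⟩, Or.inr h⟩

lemma prod_diagEdges {M : Type*} [CommMonoid M] (hn : 4 ≤ n) (f : ℕ × ℕ → M) :
    ∏ e ∈ diagEdges n T, f e =
      f (1, 2) * ∏ t ∈ triples n T, f (t.1, t.2.2) * f (t.2.1, t.2.2) := by
  rw [prod_triples T hn, diagEdges_eq T hn, Finset.prod_insert, Finset.prod_biUnion]
  · congr 1
    refine Finset.prod_congr rfl fun r _ => Finset.prod_pair ?_
    have := tripleOf_lt T hn r
    simp only [ne_eq, Prod.mk.injEq]
    omega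
  · intro r hr s hs hrs
    have hr' := tripleOf_last T hn (Finset.mem_range.1 hr)
    have hs' := tripleOf_last T hn (Finset.mem_range.1 hs)
    rw [Function.onFun, Finset.disjoint_left]
    simp only [Finset.mem_insert, Finset.mem_singleton, hr', hs']
    rintro e (rfl | rfl) <;> simp [hrs]
  · simp only [Finset.mem_biUnion, Finset.mem_range, Finset.mem_insert, Finset.mem_singleton,
      Prod.mk.injEq, not_exists, not_and]
    intro r hr
    have := tripleOf_last T hn hr
    omega

lemma prod_triples_edges {M : Type*} [CommMonoid M] (hn : 4 ≤ n) (f : ℕ × ℕ → M) :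
    ∏ t ∈ triples n T, f (t.1, t.2.1) * f (t.1, t.2.2) * f (t.2.1, t.2.2) =
      ∏ e ∈ diagEdges n T, f e ^ vTil n T e := by
  have hL : ∀ t ∈ triples n T, f (t.1, t.2.1) * f (t.1, t.2.2) * f (t.2.1, t.2.2) =
      ∏ e ∈ {(t.1, t.2.1), (t.1, t.2.2), (t.2.1, t.2.2)}, f e := by
    intro t ht
    have := lt_of_mem_triples T hn ht
    rw [Finset.prod_insert, Finset.prod_pair, mul_assoc]
    · simp only [ne_eq, Prod.mk.injEq]; omega
    · simp only [Finset.mem_insert, Finset.mem_singleton, Prod.mk.injEq]; omega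
  have hR : ∀ e ∈ diagEdges n T, f e ^ vTil n T e =
      ∏ _t ∈ (triples n T).filter (inTriple e), f e := fun e _ => by
    rw [Finset.prod_const, vTil]
  rw [Finset.prod_congr rfl hL, Finset.prod_congr rfl hR]
  refine Finset.prod_comm' fun t e => ?_
  simp only [diagEdges, inTriple, Finset.mem_biUnion, Finset.mem_filter, Finset.mem_insert,
    Finset.mem_singleton]
  exact ⟨fun h => ⟨h, t, h⟩, fun h => h.1⟩

end Diagram

section Minors

variable {n : ℕ} (T : TwoTree n)

lemma maxMinor_one_two (hn : 4 ≤ n) :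
    maxMinor n T 1 2 = ∏ t ∈ triples n T, pcP n t.1 t.2.1 := by
  have hcol : ∀ d : Fin (n - 2), (delCols n (1 - 1) (2 - 1) d : ℕ) = d + 2 := fun d => by
    simp [delCols]
  rw [maxMinor, Matrix.det_of_isLowerTriangular, prod_triples T hn,
    ← Fin.prod_univ_eq_prod_range (fun r => pcP n (tripleOf n T r).1 (tripleOf n T r).2.1)]
  · refine Finset.prod_congr rfl fun r _ => ?_
    have hlast := tripleOf_last T hn r.2
    have hlt := tripleOf_lt T hn r
    simp only [Matrix.of_apply, Mmat, hcol]
    rw [if_neg (by omega), if_neg (by omega), if_pos (by omega)]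
  · intro r d hrd
    have hrd : (r : ℕ) < d := hrd
    have hlast := tripleOf_last T hn r.2
    have hlt := tripleOf_lt T hn r
    simp only [Matrix.of_apply, Mmat, hcol]
    rw [if_neg (by omega), if_neg (by omega), if_neg (by omega)]

lemma sum_Mmat_mul (hn : 4 ≤ n) (r : Fin (n - 2)) (u : ℕ → MvPolynomial (Fin (n - 3)) ℂ) :
    ∑ c : Fin n, Mmat n T r c * u (c + 1) =
      pcP n (tripleOf n T r).2.1 (tripleOf n T r).2.2 * u (tripleOf n T r).1 -
        pcP n (tripleOf n T r).1 (tripleOf n T r).2.2 * u (tripleOf n T r).2.1 +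
        pcP n (tripleOf n T r).1 (tripleOf n T r).2.1 * u (tripleOf n T r).2.2 := by
  have hlt := tripleOf_lt T hn r
  generalize hi : (tripleOf n T r).1 = i at *
  generalize hj : (tripleOf n T r).2.1 = j at *
  generalize hk : (tripleOf n T r).2.2 = k at *
  have hterm : ∀ c : Fin n, Mmat n T r c * u (c + 1) =
      (if c = (⟨i - 1, by omega⟩ : Fin n) then pcP n j k * u i else 0) +
      (if c = (⟨j - 1, by omega⟩ : Fin n) then -pcP n i k * u j else 0) +
      (if c = (⟨k - 1, by omega⟩ : Fin n) then pcP n i j * u k else 0) := by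
    intro c
    have h : ∀ m, 1 ≤ m → ((c : ℕ) = m - 1 ↔ (c : ℕ) + 1 = m) := by omega
    simp only [Mmat, Matrix.of_apply, hi, hj, hk, Fin.ext_iff, h i (by omega), h j (by omega),
      h k (by omega)]
    split_ifs <;> first | omega | simp_all
  simp only [hterm, Finset.sum_add_distrib, Finset.sum_ite_eq', Finset.mem_univ, if_true]
  ring

/-- All columns of `M_T` are combinations of columns `3, …, n`, because the rows of `X` are
orthogonal to those of `M_T` and `p_{12} = 1`. -/
lemma Mmat_eq_mul (hn : 4 ≤ n) :
    ∃ K : Matrix (Fin (n - 2)) (Fin n) (MvPolynomial (Fin (n - 3)) ℂ),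
      Mmat n T = Matrix.of (fun r d : Fin (n - 2) => Mmat n T r (delCols n 0 1 d)) * K := by
  obtain ⟨m, rfl⟩ : ∃ m, n = m + 2 := ⟨n - 2, by omega⟩
  have hcol : ∀ d : Fin m, delCols (m + 2) 0 1 d = d.succ.succ := fun d => by
    ext; simp [delCols]
  have hA (r : Fin m) := (sum_Mmat_mul T hn r (colAP (m + 2))).trans (pcP_colAP_relation _ _ _)
  have hB (r : Fin m) := (sum_Mmat_mul T hn r (colBP (m + 2))).trans (pcP_colBP_relation _ _ _)
  have hA1 : colAP (m + 2) 1 = 1 := if_neg (by omega)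
  have hA2 : colAP (m + 2) 2 = 1 := if_neg (by omega)
  have hB1 : colBP (m + 2) 1 = 0 := if_pos rfl
  have hB2 : colBP (m + 2) 2 = 1 := by simp [colBP]
  simp only [Fin.sum_univ_succ, Fin.val_zero, Fin.val_succ, zero_add, Nat.reduceAdd,
    add_assoc, hA1, hA2, hB1, hB2, mul_one, mul_zero] at hA hB
  refine ⟨Matrix.of fun d c => Fin.cases (colBP (m + 2) (d + 3) - colAP (m + 2) (d + 3))
    (Fin.cases (-colBP (m + 2) (d + 3)) fun c' => if d = c' then 1 else 0) c, ?_⟩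
  ext1 r c
  rw [Matrix.mul_apply]
  simp only [Matrix.of_apply, hcol]
  refine Fin.cases ?_ (Fin.cases ?_ fun c' => ?_) c
  · simp only [Fin.cases_zero, mul_sub, Finset.sum_sub_distrib]
    have elim : ∀ {a b s t : MvPolynomial (Fin (m + 2 - 3)) ℂ},
        a + (b + s) = 0 → b + t = 0 → a = t - s := fun h h' => by linear_combination h - h'
    exact elim (hA r) (hB r)
  · simp only [Fin.cases_succ, Fin.cases_zero, mul_neg, Finset.sum_neg_distrib]
    exact eq_neg_of_add_eq_zero_left (hB r)
  · simp

lemma maxMinor_one_two_dvd (hn : 4 ≤ n) (i j : ℕ) : maxMinor n T 1 2 ∣ maxMinor n T i j := by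
  obtain ⟨K, hK⟩ := Mmat_eq_mul T hn
  refine ⟨(K.submatrix id (delCols n (i - 1) (j - 1))).det, ?_⟩
  rw [maxMinor, maxMinor, ← Matrix.det_mul]
  congr 1
  ext1 r d
  rw [Matrix.of_apply, congrFun₂ hK, Matrix.mul_apply, Matrix.mul_apply]
  rfl

end Minors


/-- in the field of rational functions,
Δ(M_T)² / Π_{triples} (p_{ij} p_{ik} p_{jk}) = c · Π_e p_e^{ṽ(e)-2}
for some nonzero constant c. -/
theorem integrand_from_gcd (n : ℕ) (hn : 4 ≤ n) (T : TwoTree n)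
    (Δ : MvPolynomial (Fin (n - 3)) ℂ)
    (hdvd : ∀ i j : ℕ, 1 ≤ i → i < j → j ≤ n → Δ ∣ maxMinor n T i j)
    (hgcd : ∀ h : MvPolynomial (Fin (n - 3)) ℂ,
      (∀ i j : ℕ, 1 ≤ i → i < j → j ≤ n → h ∣ maxMinor n T i j) → h ∣ Δ) :
    ∃ c : ℂ, c ≠ 0 ∧
      (algebraMap (MvPolynomial (Fin (n - 3)) ℂ)
            (FractionRing (MvPolynomial (Fin (n - 3)) ℂ)) Δ) ^ 2 /
          (∏ t ∈ triples n T,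
            algebraMap (MvPolynomial (Fin (n - 3)) ℂ)
              (FractionRing (MvPolynomial (Fin (n - 3)) ℂ))
              (pcP n t.1 t.2.1 * pcP n t.1 t.2.2 * pcP n t.2.1 t.2.2)) =
        algebraMap (MvPolynomial (Fin (n - 3)) ℂ)
            (FractionRing (MvPolynomial (Fin (n - 3)) ℂ)) (MvPolynomial.C c) *
          ∏ e ∈ diagEdges n T,
            (algebraMap (MvPolynomial (Fin (n - 3)) ℂ)
                (FractionRing (MvPolynomial (Fin (n - 3)) ℂ))
                (pcP n e.1 e.2)) ^ ((vTil n T e : ℤ) - 2) := by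
  set φ := algebraMap (MvPolynomial (Fin (n - 3)) ℂ)
    (FractionRing (MvPolynomial (Fin (n - 3)) ℂ))
  have hφ : Function.Injective φ := IsFractionRing.injective _ _
  obtain ⟨u, hu⟩ : Associated (maxMinor n T 1 2) Δ :=
    associated_of_dvd_dvd (hgcd _ fun i j _ _ _ => maxMinor_one_two_dvd T hn i j)
      (hdvd 1 2 le_rfl one_lt_two (by omega))
  obtain ⟨c, hc, hcu⟩ := MvPolynomial.isUnit_iff_eq_C_of_isReduced.1 u.isUnit
  have hc0 : c ≠ 0 := hc.ne_zero
  set f : ℕ × ℕ → FractionRing (MvPolynomial (Fin (n - 3)) ℂ) := fun e => φ (pcP n e.1 e.2) with hf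
  have hf0 : ∀ e ∈ diagEdges n T, f e ≠ 0 := fun e he => by
    obtain ⟨h1, h2, h3⟩ := lt_of_mem_diagEdges T hn he
    exact (map_ne_zero_iff φ hφ).2 (pcP_ne_zero hn h1 h2 h3)
  have hf12 : f (1, 2) = 1 := by simp [hf, pcP_one_two hn]
  have hE0 : ∏ e ∈ diagEdges n T, f e ≠ 0 := Finset.prod_ne_zero_iff.2 hf0
  have hD : φ (maxMinor n T 1 2) = ∏ t ∈ triples n T, f (t.1, t.2.1) := by
    rw [maxMinor_one_two T hn, map_prod]
  have hP := prod_triples_edges T hn f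
  have hDE : ∏ t ∈ triples n T, f (t.1, t.2.1) * f (t.1, t.2.2) * f (t.2.1, t.2.2) =
      φ (maxMinor n T 1 2) * ∏ e ∈ diagEdges n T, f e := by
    rw [prod_diagEdges T hn f, hf12, one_mul, hD, ← Finset.prod_mul_distrib]
    exact Finset.prod_congr rfl fun t _ => mul_assoc _ _ _
  have hD0 : φ (maxMinor n T 1 2) ≠ 0 := by
    rw [hD]
    refine Finset.prod_ne_zero_iff.2 fun t ht => hf0 _ ?_
    exact Finset.mem_biUnion.2 ⟨t, ht, Finset.mem_insert_self _ _⟩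
  have hR : ∏ e ∈ diagEdges n T, f e ^ ((vTil n T e : ℤ) - 2) =
      (∏ e ∈ diagEdges n T, f e ^ vTil n T e) / (∏ e ∈ diagEdges n T, f e) ^ 2 := by
    rw [← Finset.prod_pow, ← Finset.prod_div_distrib]
    refine Finset.prod_congr rfl fun e he => ?_
    rw [zpow_sub₀ (hf0 e he), zpow_natCast, zpow_ofNat]
  refine ⟨c ^ 2, pow_ne_zero 2 hc0, ?_⟩
  simp only [map_mul φ (_ * _), map_mul φ (pcP _ _ _) (pcP _ _ _)]
  change φ Δ ^ 2 / (∏ t ∈ triples n T, f (t.1, t.2.1) * f (t.1, t.2.2) * f (t.2.1, t.2.2)) =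
    _ * ∏ e ∈ diagEdges n T, f e ^ ((vTil n T e : ℤ) - 2)
  rw [hR, ← hP, hDE, ← hu, hcu, map_pow, map_mul, map_pow]
  field_simp

end

end MinKin
end

section
/- Let T be a 2-tree on [n−1] that is planar, meaning that every edge contained in a triple of the on-shell diagram of T lies in at most two of its n−2 triples and the edges lying in exactly one triple are precisely {1,n}, {2,n}, {2,3}, {3,4}, …, {n−2,n−1} and {1,n−1}. Then the CHY integrand equals the Parke–Taylor factor: I_T(x) = 1 / ( p_{1n}(x)·p_{2n}(x)·p_{23}(x)·p_{34}(x) ⋯ p_{n−2,n−1}(x)·p_{1,n−1}(x) ). -/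
namespace MinKin

noncomputable section

attribute [local instance] Classical.propDecidable

open scoped BigOperators

/-- Every edge of the on-shell diagram lies in at least one of its triples. -/
theorem one_le_vTil {n : ℕ} {T : TwoTree n} {e : ℕ × ℕ} (he : e ∈ diagEdges n T) :
    1 ≤ vTil n T e := by
  obtain ⟨t, ht, het⟩ := Finset.mem_biUnion.mp he
  refine Finset.card_pos.mpr ⟨t, Finset.mem_filter.mpr ⟨ht, ?_⟩⟩
  simpa [inTriple] using het

/-- If every edge lies in at most two triples, only the edges lying in exactly one triple
contribute to the integrand. -/
theorem integrand_eq_inv_prod {n : ℕ} {T : TwoTree n}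
    (h : ∀ e ∈ diagEdges n T, vTil n T e ≤ 2) (x : Fin (n - 3) → ℂ) :
    integrand n T x =
      (∏ e ∈ (diagEdges n T).filter (fun e => vTil n T e = 1), pc n x e.1 e.2)⁻¹ := by
  rw [integrand, ← Finset.prod_inv_distrib, Finset.prod_filter]
  refine Finset.prod_congr rfl fun e he => ?_
  have hpos := one_le_vTil he
  have hle := h e he
  obtain hv | hv : vTil n T e = 1 ∨ vTil n T e = 2 := by omega
  · rw [if_pos hv, hv, ← zpow_neg_one]
    norm_num
  · rw [if_neg (by omega), hv]
    norm_num

/-- Corollary 4.4: for a planar 2-tree the CHY integrand is the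
Parke-Taylor factor 1/(p_{1n} p_{2n} p_{23} p_{34} ⋯ p_{n-2,n-1} p_{1,n-1}). -/
theorem planar_integrand_is_parke_taylor (n : ℕ) (hn : 4 ≤ n) (T : TwoTree n)
    (h2 : ∀ e ∈ diagEdges n T, vTil n T e ≤ 2)
    (h1 : (diagEdges n T).filter (fun e => vTil n T e = 1) =
      insert (1, n) (insert (2, n) (insert (1, n - 1)
        ((Finset.Icc 2 (n - 2)).image fun k => (k, k + 1))))) :
    ∀ x ∈ Udom n,
      integrand n T x =
        (pc n x 1 n * pc n x 2 n * (∏ k ∈ Finset.Icc 2 (n - 2), pc n x k (k + 1)) *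
            pc n x 1 (n - 1))⁻¹ := by
  intro x _
  have inj : Set.InjOn (fun k : ℕ => (k, k + 1)) (Finset.Icc 2 (n - 2)) :=
    fun a _ b _ hab => congrArg Prod.fst hab
  rw [integrand_eq_inv_prod h2, h1, Finset.prod_insert, Finset.prod_insert, Finset.prod_insert,
    Finset.prod_image inj]
  · ring
  all_goals
    simp only [Finset.mem_insert, Finset.mem_image, Finset.mem_Icc, Prod.mk.injEq, not_or,
      not_exists]
    grind

end
end MinKin
end

section
/- For every integer n ≥ 4, the number of distinct edge sets that are 2-trees on [n−1] equals the double factorial (2n−7)!! = 1·3·5 ⋯ (2n−7) = Π_{k=4}^{n−1} (2k−5). -/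
namespace MinKin

noncomputable section

attribute [local instance] Classical.propDecidable

open scoped BigOperators

/-- Attach a new vertex `m` to the endpoints of the edge `e`. -/
def attachVertex (m : ℕ) (E : Finset (ℕ × ℕ)) (e : ℕ × ℕ) : Finset (ℕ × ℕ) :=
  E ∪ {(e.1, m), (e.2, m)}

/-- The finset of edge sets of 2-trees on `[j+2]`. -/
def twoTreeFinset : ℕ → Finset (Finset (ℕ × ℕ))
  | 0 => {{(1, 2)}}
  | j + 1 => ((twoTreeFinset j).sigma id).image fun p => attachVertex (j + 3) p.1 p.2

theorem mem_attachVertex {m : ℕ} {E : Finset (ℕ × ℕ)} {e f : ℕ × ℕ} :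
    f ∈ attachVertex m E e ↔ f ∈ E ∨ f = (e.1, m) ∨ f = (e.2, m) := by
  rw [attachVertex, Finset.mem_union, Finset.mem_insert, Finset.mem_singleton]

theorem mem_twoTreeFinset_succ {j : ℕ} {E : Finset (ℕ × ℕ)} :
    E ∈ twoTreeFinset (j + 1) ↔
      ∃ E' ∈ twoTreeFinset j, ∃ e ∈ E', attachVertex (j + 3) E' e = E := by
  simp [twoTreeFinset, and_assoc]

theorem bounds_of_mem_twoTreeFinset {j : ℕ} {E : Finset (ℕ × ℕ)} (hE : E ∈ twoTreeFinset j)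
    {e : ℕ × ℕ} (he : e ∈ E) : e.1 < e.2 ∧ e.2 < j + 3 := by
  induction j generalizing E e with
  | zero =>
    obtain rfl : E = {(1, 2)} := by simpa [twoTreeFinset] using hE
    obtain rfl : e = (1, 2) := by simpa using he
    decide
  | succ j ih =>
    obtain ⟨E', hE', f, hf, rfl⟩ := mem_twoTreeFinset_succ.1 hE
    have hb := ih hE' hf
    rcases mem_attachVertex.1 he with h | rfl | rfl
    · have := ih hE' h
      omega
    · dsimp only
      omega
    · dsimp only
      omega

theorem card_attachVertex {m : ℕ} {E : Finset (ℕ × ℕ)} {e : ℕ × ℕ}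
    (hE : ∀ f ∈ E, f.2 < m) (he : e.1 < e.2) :
    (attachVertex m E e).card = E.card + 2 := by
  rw [attachVertex, Finset.card_union_of_disjoint, Finset.card_pair]
  · simpa using he.ne
  · rw [Finset.disjoint_left]
    intro f hf hf'
    have := hE f hf
    rcases (by simpa using hf' : f = (e.1, m) ∨ f = (e.2, m)) with rfl | rfl <;>
      exact lt_irrefl _ this

theorem attachVertex_inj {m : ℕ} {E E' : Finset (ℕ × ℕ)} {e e' : ℕ × ℕ}
    (hE : ∀ f ∈ E, f.2 < m) (hE' : ∀ f ∈ E', f.2 < m) (he : e.1 < e.2) (he' : e'.1 < e'.2)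
    (h : attachVertex m E e = attachVertex m E' e') : E = E' ∧ e = e' := by
  have key (f : ℕ × ℕ) : (f ∈ E ∨ f = (e.1, m) ∨ f = (e.2, m)) ↔
      (f ∈ E' ∨ f = (e'.1, m) ∨ f = (e'.2, m)) := by
    rw [← mem_attachVertex, ← mem_attachVertex, h]
  constructor
  · ext f
    have := key f
    have := hE f
    have := hE' f
    grind
  · have h1 := key (e.1, m)
    have h2 := key (e.2, m)
    have h3 := hE' (e.1, m)
    have h4 := hE' (e.2, m)
    simp only [Prod.mk.injEq, and_true] at h1 h2
    refine Prod.ext ?_ ?_ <;> grind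

theorem card_of_mem_twoTreeFinset {j : ℕ} {E : Finset (ℕ × ℕ)} (hE : E ∈ twoTreeFinset j) :
    E.card = 2 * j + 1 := by
  induction j generalizing E with
  | zero =>
    obtain rfl : E = {(1, 2)} := by simpa [twoTreeFinset] using hE
    simp
  | succ j ih =>
    obtain ⟨E', hE', f, hf, rfl⟩ := mem_twoTreeFinset_succ.1 hE
    rw [card_attachVertex (fun g hg => (bounds_of_mem_twoTreeFinset hE' hg).2)
      (bounds_of_mem_twoTreeFinset hE' hf).1, ih hE']
    ring

theorem card_twoTreeFinset_succ (j : ℕ) :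
    (twoTreeFinset (j + 1)).card = (twoTreeFinset j).card * (2 * j + 1) := by
  rw [twoTreeFinset, Finset.card_image_of_injOn, Finset.card_sigma]
  · exact Finset.sum_const_nat fun E hE => card_of_mem_twoTreeFinset hE
  · rintro ⟨E, e⟩ hp ⟨E', e'⟩ hp' h
    obtain ⟨hE, he⟩ := Finset.mem_sigma.1 hp
    obtain ⟨hE', he'⟩ := Finset.mem_sigma.1 hp'
    obtain ⟨rfl, rfl⟩ := attachVertex_inj
      (fun g hg => (bounds_of_mem_twoTreeFinset hE hg).2)
      (fun g hg => (bounds_of_mem_twoTreeFinset hE' hg).2)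
      (bounds_of_mem_twoTreeFinset hE he).1 (bounds_of_mem_twoTreeFinset hE' he').1 h
    rfl

theorem card_twoTreeFinset (j : ℕ) :
    (twoTreeFinset (j + 1)).card = ∏ k ∈ Finset.Icc 4 (j + 3), (2 * k - 5) := by
  induction j with
  | zero =>
    rw [card_twoTreeFinset_succ]
    simp [twoTreeFinset]
  | succ j ih =>
    rw [card_twoTreeFinset_succ, ih, Nat.add_right_comm j 1 3,
      Finset.prod_Icc_succ_top (by omega : 4 ≤ j + 3 + 1)]
    congr 1

theorem edgesUpTo_congr {p q : ℕ → ℕ × ℕ} {m : ℕ} (h : ∀ k ≤ m, p k = q k) :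
    edgesUpTo p m = edgesUpTo q m := by
  induction m with
  | zero => rfl
  | succ m ih =>
    simp only [edgesUpTo, h (m + 1) le_rfl, ih fun k hk => h k (hk.trans m.le_succ)]

theorem edgesUpTo_succ (p : ℕ → ℕ × ℕ) {m : ℕ} (hm : 2 ≤ m) :
    edgesUpTo p (m + 1) = attachVertex (m + 1) (edgesUpTo p m) (p (m + 1)) := by
  rw [edgesUpTo, if_neg (by omega), attachVertex]

theorem isTwoTree_three {E : Finset (ℕ × ℕ)} : IsTwoTree 3 E ↔ E = {(1, 2)} := by
  constructor
  · rintro ⟨T, rfl⟩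
    simp [TwoTree.edges, edgesUpTo]
  · rintro rfl
    exact ⟨⟨fun _ => (1, 2), fun k _ _ => by omega, fun k _ _ => by omega⟩,
      by simp [TwoTree.edges, edgesUpTo]⟩

theorem mem_twoTreeFinset {j : ℕ} {E : Finset (ℕ × ℕ)} :
    E ∈ twoTreeFinset j ↔ IsTwoTree (j + 3) E := by
  induction j generalizing E with
  | zero => simp [twoTreeFinset, isTwoTree_three]
  | succ j ih =>
    rw [mem_twoTreeFinset_succ]
    constructor
    · rintro ⟨E', hE', e, he, rfl⟩
      have hb := bounds_of_mem_twoTreeFinset hE' he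
      obtain ⟨T, rfl⟩ := ih.1 hE'
      have hpar (k : ℕ) (hk : k ≤ j + 2) : Function.update T.par (j + 3) e k = T.par k :=
        Function.update_of_ne (by omega) _ _
      have hedges (m : ℕ) (hm : m ≤ j + 2) :
          edgesUpTo (Function.update T.par (j + 3) e) m = edgesUpTo T.par m :=
        edgesUpTo_congr fun k hk => hpar k (hk.trans hm)
      refine ⟨⟨Function.update T.par (j + 3) e, fun k h3 hk => ?_, fun k h3 hk => ?_⟩, ?_⟩
      · obtain rfl | hk' : k = j + 3 ∨ k ≤ j + 2 := by omega
        · simpa using hb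
        · rw [hpar k hk']
          exact T.lt k h3 (by omega)
      · rw [hedges (k - 1) (by omega)]
        obtain rfl | hk' : k = j + 3 ∨ k ≤ j + 2 := by omega
        · simpa [TwoTree.edges] using he
        · rw [hpar k hk']
          exact T.mem k h3 (by omega)
      · change edgesUpTo (Function.update T.par (j + 3) e) (j + 2 + 1) = _
        rw [edgesUpTo_succ _ (by omega), hedges (j + 2) le_rfl, Function.update_self]
        rfl
    · rintro ⟨T, rfl⟩
      refine ⟨edgesUpTo T.par (j + 2), ih.2 ⟨⟨T.par, fun k h3 hk => T.lt k h3 (by omega),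
        fun k h3 hk => T.mem k h3 (by omega)⟩, rfl⟩, T.par (j + 3),
        T.mem (j + 3) (by omega) (by omega), ?_⟩
      exact (edgesUpTo_succ T.par (by omega : 2 ≤ j + 2)).symm

/-- the number of distinct edge sets that are 2-trees on [n-1]
equals (2n-7)!! = Π_{k=4}^{n-1} (2k-5). -/
theorem count_twoTrees (n : ℕ) (hn : 4 ≤ n) :
    {E : Finset (ℕ × ℕ) | IsTwoTree n E}.Finite ∧
      {E : Finset (ℕ × ℕ) | IsTwoTree n E}.ncard =
        ∏ k ∈ Finset.Icc 4 (n - 1), (2 * k - 5) := by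
  obtain ⟨j, rfl⟩ := Nat.exists_eq_add_of_le' hn
  have hset : {E : Finset (ℕ × ℕ) | IsTwoTree (j + 4) E} = twoTreeFinset (j + 1) :=
    Set.ext fun E => mem_twoTreeFinset.symm
  rw [hset, Set.ncard_coe_finset]
  exact ⟨Finset.finite_toSet _, card_twoTreeFinset j⟩

end
end MinKin
end

section
/- Let n = 6 and let T be the octahedral hypertree {{1,2,3},{3,4,5},{1,5,6},{2,4,6}}, whose edges are all pairs {i,j} ⊆ {1,…,6} except {1,4}, {2,5} and {3,6}. Consider Mandelstam invariants s = (s_{ij})_{1≤i<j≤6} extended symmetrically with s_{ii} = 0, constrained by momentum conservation Σ_{j≠i} s_{ij} = 0 for all i = 1,…,6 and by s_{14} = s_{25} = s_{36} = 0; these constraints define a linear subspace V of ℂ^{15}. There exists a nonzero polynomial g on V such that for every s ∈ V with g(s) ≠ 0, the restricted scattering potential L_T(x) = Σ_{1≤i<j≤6} s_{ij}·log p_{ij}(x) has exactly two critical points in U, i.e. exactly two points x ∈ U with Σ_{1≤i<j≤6} s_{ij}·(∂p_{ij}/∂x_m)(x)/p_{ij}(x) = 0 for m = 1,2,3; in other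 words, the octahedral hypertree has maximum likelihood degree 2. -/
namespace MinKin

noncomputable section

attribute [local instance] Classical.propDecidable

open scoped BigOperators

/-- The symmetric extension of Mandelstam invariants, with s_{ii} = 0. -/
def sext (s : ℕ × ℕ → ℂ) (i j : ℕ) : ℂ :=
  if i < j then s (i, j) else if j < i then s (j, i) else 0

/-- All pairs 1 ≤ i < j ≤ 6. -/
def P6 : Finset (ℕ × ℕ) :=
  ((Finset.Icc 1 6) ×ˢ (Finset.Icc 1 6)).filter fun e => e.1 < e.2

/-- The subspace V: momentum conservation together with s₁₄ = s₂₅ = s₃₆ = 0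
(the kinematics of the octahedral hypertree {123,345,156,246}). -/
def InV (s : ℕ × ℕ → ℂ) : Prop :=
  (∀ i ∈ Finset.Icc 1 6, ∑ j ∈ Finset.Icc 1 6, sext s i j = 0) ∧
    s (1, 4) = 0 ∧ s (2, 5) = 0 ∧ s (3, 6) = 0

/-- Leading coefficient of the quadratic whose roots parametrize the critical points. -/
def quadA {R : Type*} [CommRing R] (a c d e f h : R) : R := (e + c + f) * (h + d + a)

/-- Linear coefficient of the quadratic whose roots parametrize the critical points. -/
def quadB {R : Type*} [CommRing R] (a b c d e f h : R) : R :=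
  d * f * ((h + d) - (e + c + f)) + (c + d) * (h + d) * (e + c + f) + a * (d * f)
    + a * (d - f) * (e + c + f) + b * (c + f) * (h + d)

/-- Constant coefficient of the quadratic whose roots parametrize the critical points. -/
def quadC {R : Type*} [CommRing R] (a b c d e f h : R) : R :=
  d * f * (-(d * f) + (c + d) * ((h + d) - (e + c + f)) + a * (d - f - (e + c + f))
    + b * ((h + d) - c - f))

/-- The resultant of `A T² + B T + C` and `α T + β`. -/
def linRes {R : Type*} [CommRing R] (A B C α β : R) : R := A * β ^ 2 - B * α * β + C * α ^ 2

/-- The resultant of `A T² + B T + C` and `p T² + q T + r`. -/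
def quadRes {R : Type*} [CommRing R] (A B C p q r : R) : R :=
  (A * r - p * C) ^ 2 - (A * q - p * B) * (B * r - q * C)

/-- The genericity polynomial, in terms of the coefficients of the quadratic and the
Mandelstam invariants. -/
def genericityAux {R : Type*} [CommRing R] (A B C c d e f h : R) : R :=
  c * d * e * h * A * (B * B - 4 * A * C) * linRes A B C 1 0 * linRes A B C 1 d
    * linRes A B C 1 (-f) * linRes A B C (-1) (h + f) * linRes A B C (h + d) (-(d * f))
    * linRes A B C (e + c + f) (d * f) * linRes A B C (e + c + f) ((e + f) * d)
    * linRes A B C (c + f) (d * f)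
    * quadRes A B C (e + c + f) (e * (d - f) - (c + f) * (h + f) + d * f)
        (-(e * (d * f)) - d * f * (h + f))

/-- The genericity polynomial in the Mandelstam invariants
`a = s₁₃, b = s₂₃, c = s₃₄, d = s₃₅, e = s₂₄, f = s₄₅, h = s₁₅`. -/
def genericity {R : Type*} [CommRing R] (a b c d e f h : R) : R :=
  genericityAux (quadA a c d e f h) (quadB a b c d e f h) (quadC a b c d e f h) c d e f h

lemma map_genericity {R S : Type*} [CommRing R] [CommRing S] (φ : R →+* S)
    (a b c d e f h : R) :
    φ (genericity a b c d e f h)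
      = genericity (φ a) (φ b) (φ c) (φ d) (φ e) (φ f) (φ h) := by
  have h4 : φ 4 = 4 := map_ofNat φ 4
  simp [genericity, genericityAux, quadA, quadB, quadC, linRes, quadRes, h4]

lemma linear_ne_zero_of_linRes_ne_zero {R : Type*} [CommRing R] {A B C α β T : R}
    (hT : A * (T * T) + B * T + C = 0) (h : linRes A B C α β ≠ 0) : α * T + β ≠ 0 := by
  intro h0
  apply h
  unfold linRes
  linear_combination α ^ 2 * hT + (A * β - B * α - A * α * T) * h0

lemma quadratic_ne_zero_of_quadRes_ne_zero {K : Type*} [Field K] {A B C p q r T : K}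
    (hA : A ≠ 0) (hT : A * (T * T) + B * T + C = 0) (h : quadRes A B C p q r ≠ 0) :
    p * T ^ 2 + q * T + r ≠ 0 := by
  intro h0
  have h1 : (A * q - p * B) * T + (A * r - p * C) = 0 := by
    linear_combination A * h0 - p * hT
  have h2 : linRes A B C (A * q - p * B) (A * r - p * C) = A * quadRes A B C p q r := by
    unfold linRes quadRes; ring
  exact linear_ne_zero_of_linRes_ne_zero hT (h2 ▸ mul_ne_zero hA h) h1

/-- The conditions on a root `T` of the quadratic under which it gives a critical point. -/
structure Nondegenerate {K : Type*} [Field K] (c d e f h T : K) : Prop where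
  c_ne : c ≠ 0
  d_ne : d ≠ 0
  e_ne : e ≠ 0
  h_ne : h ≠ 0
  T_ne : T ≠ 0
  add_d : T + d ≠ 0
  sub_f : T - f ≠ 0
  one_sub_t : h + f - T ≠ 0
  L_ne : (h + d) * T - d * f ≠ 0
  M_ne : (e + c + f) * T + d * f ≠ 0
  one_sub_r : (e + c + f) * T + (e + f) * d ≠ 0
  r_ne : (c + f) * T + d * f ≠ 0
  D_ne : e * (T - f) * (T + d) - ((c + f) * T + d * f) * (h + f - T) ≠ 0

lemma nondegenerate_of_genericity_ne_zero {K : Type*} [Field K] {a b c d e f h T : K}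
    (hG : genericity a b c d e f h ≠ 0)
    (hT : quadA a c d e f h * (T * T) + quadB a b c d e f h * T + quadC a b c d e f h = 0) :
    Nondegenerate c d e f h T := by
  simp only [genericity, genericityAux, mul_ne_zero_iff] at hG
  obtain ⟨⟨⟨⟨⟨⟨⟨⟨⟨⟨⟨⟨⟨⟨hc, hd⟩, he⟩, hh⟩, hA⟩, -⟩, h1⟩, h2⟩, h3⟩, h4⟩, h5⟩, h6⟩, h7⟩, h8⟩, h9⟩ :=
    hG
  replace h1 := linear_ne_zero_of_linRes_ne_zero hT h1
  replace h2 := linear_ne_zero_of_linRes_ne_zero hT h2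
  replace h3 := linear_ne_zero_of_linRes_ne_zero hT h3
  replace h4 := linear_ne_zero_of_linRes_ne_zero hT h4
  replace h5 := linear_ne_zero_of_linRes_ne_zero hT h5
  replace h6 := linear_ne_zero_of_linRes_ne_zero hT h6
  replace h7 := linear_ne_zero_of_linRes_ne_zero hT h7
  replace h8 := linear_ne_zero_of_linRes_ne_zero hT h8
  replace h9 := quadratic_ne_zero_of_quadRes_ne_zero hA hT h9
  exact ⟨hc, hd, he, hh, by simpa using h1, by simpa using h2,
    by simpa [sub_eq_add_neg] using h3, fun h0 => h4 (by linear_combination h0),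
    fun h0 => h5 (by linear_combination h0), h6, h7, h8,
    fun h0 => h9 (by linear_combination h0)⟩

lemma reduced_equation {K : Type*} [Field K] {a b c d e f h T R : K}
    (habcd : a + b + c + d = 0) (hc : c ≠ 0) (hT : T ≠ 0) (hd : T + d ≠ 0)
    (hL : (h + d) * T - d * f ≠ 0) (hM : (e + c + f) * T + d * f ≠ 0)
    (hR : R = -c * T / (T + d)) :
    a * (T - f) * T / ((h + d) * T - d * f) - b * (R - f) * R / ((e + c) * R - c * f) - R + T
      = T ^ 2 * (quadA a c d e f h * (T * T) + quadB a b c d e f h * T + quadC a b c d e f h)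
        / ((T + d) * ((h + d) * T - d * f) * ((e + c + f) * T + d * f)) := by
  have h1 : (e + c) * R - c * f = -c * ((e + c + f) * T + d * f) / (T + d) := by
    rw [hR]; field_simp; ring
  have ha : a = -(b + c + d) := by linear_combination habcd
  rw [h1, hR, ha]
  obtain ⟨L, hL'⟩ : ∃ L, L = (h + d) * T - d * f := ⟨_, rfl⟩
  obtain ⟨M, hM'⟩ : ∃ M, M = (e + c + f) * T + d * f := ⟨_, rfl⟩
  rw [← hL'] at hL
  rw [← hM'] at hM
  rw [← hL', ← hM']
  unfold quadA quadB quadC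
  field_simp
  rw [hL', hM']
  ring

/-- The three critical equations in the coordinates `x, y, z` of the points 3, 4, 5. -/
def OctCrit {K : Type*} [Field K] (a b c d e f h x y z : K) : Prop :=
  a / x + b / (x - 1) - c / (y - x) - d / (z - x) = 0 ∧
    e / (y - 1) + c / (y - x) - f / (z - y) = 0 ∧ h / z + d / (z - x) + f / (z - y) = 0

/-- The nonvanishing of the Plücker coordinates. -/
structure OctDom {K : Type*} [Field K] (x y z : K) : Prop where
  x0 : x ≠ 0
  y0 : y ≠ 0
  z0 : z ≠ 0
  x1 : x - 1 ≠ 0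
  y1 : y - 1 ≠ 0
  z1 : z - 1 ≠ 0
  yx : y - x ≠ 0
  zx : z - x ≠ 0
  zy : z - y ≠ 0

/-- The parameter `r = (y - z) / (y - 1)` of the critical point with parameter `T`. -/
def rOf {K : Type*} [Field K] (c d e f T : K) : K := (-c * T / (T + d) - f) / e

/-- The parameter `t = (z - y) / z` of the critical point with parameter `T`. -/
def tOf {K : Type*} [Field K] (f h T : K) : K := (T - f) / h

/-- The third coordinate of the critical point with parameter `T`. -/
def zOf {K : Type*} [Field K] (c d e f h T : K) : K :=
  rOf c d e f T / (rOf c d e f T + tOf f h T - rOf c d e f T * tOf f h T)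

/-- The second coordinate of the critical point with parameter `T`. -/
def yOf {K : Type*} [Field K] (c d e f h T : K) : K := zOf c d e f h T * (1 - tOf f h T)

/-- The first coordinate of the critical point with parameter `T`. -/
def xOf {K : Type*} [Field K] (c d e f h T : K) : K :=
  zOf c d e f h T * (T + d * tOf f h T) / T

lemma eq_of_octCrit {K : Type*} [Field K] {a b c d e f h x y z : K}
    (habcd : a + b + c + d = 0) (hc : c ≠ 0) (hd : d ≠ 0) (he : e ≠ 0) (hh : h ≠ 0)
    (hU : OctDom x y z) (hcrit : OctCrit a b c d e f h x y z) :
    ∃ T, quadA a c d e f h * (T * T) + quadB a b c d e f h * T + quadC a b c d e f h = 0 ∧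
      x = xOf c d e f h T ∧ y = yOf c d e f h T ∧ z = zOf c d e f h T := by
  obtain ⟨x0, y0, z0, x1, y1, z1, yx, zx, zy⟩ := hU
  obtain ⟨e1, e2, e3⟩ := hcrit
  have xz : x - z ≠ 0 := by rw [← neg_sub]; exact neg_ne_zero.2 zx
  have xy : x - y ≠ 0 := by rw [← neg_sub]; exact neg_ne_zero.2 yx
  have yz : y - z ≠ 0 := by rw [← neg_sub]; exact neg_ne_zero.2 zy
  obtain ⟨T, hT⟩ : ∃ T, T = d * (z - y) / (x - z) := ⟨_, rfl⟩
  obtain ⟨R, hR⟩ : ∃ R, R = c * (y - z) / (x - y) := ⟨_, rfl⟩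
  obtain ⟨t, ht⟩ : ∃ t, t = (z - y) / z := ⟨_, rfl⟩
  obtain ⟨r, hr⟩ : ∃ r, r = (y - z) / (y - 1) := ⟨_, rfl⟩
  have T0 : T ≠ 0 := by rw [hT]; exact div_ne_zero (mul_ne_zero hd zy) xz
  have R0 : R ≠ 0 := by rw [hR]; exact div_ne_zero (mul_ne_zero hc yz) xy
  have hTt : T = h * t + f := by
    have h1 : d / (z - x) = -d / (x - z) := by rw [← neg_sub x z, div_neg, neg_div]
    rw [h1] at e3
    have : h * t + f - T = (z - y) * (h / z + -d / (x - z) + f / (z - y)) := by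
      rw [hT, ht]; field_simp; ring
    rw [e3, mul_zero] at this
    linear_combination -this
  have hRr : R = e * r + f := by
    have h1 : c / (y - x) = -c / (x - y) := by rw [← neg_sub x y, div_neg, neg_div]
    have h2 : f / (z - y) = -f / (y - z) := by rw [← neg_sub y z, div_neg, neg_div]
    rw [h1, h2] at e2
    have : e * r + f - R = (y - z) * (e / (y - 1) + -c / (x - y) - -f / (y - z)) := by
      rw [hR, hr]; field_simp; ring
    rw [e2, mul_zero] at this
    linear_combination -this
  have hA : R * (T + d) = -c * T := by
    rw [hT, hR]; field_simp; ring
  have Td : T + d ≠ 0 := by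
    intro h0
    rw [h0, mul_zero] at hA
    exact mul_ne_zero (neg_ne_zero.2 hc) T0 hA.symm
  have hRT : R = -c * T / (T + d) := by field_simp; linear_combination hA
  have hL : (h + d) * T - d * f = h * (d * (z - y) / ((x - z) * z) * x) := by
    have : (h + d) * T - d * f = h * (T + d * t) := by rw [hTt]; ring
    rw [this, hT, ht]; field_simp; ring
  have hM1 : (e + c) * R - c * f = e * (c * (y - z) / ((x - y) * (y - 1)) * (x - 1)) := by
    have : (e + c) * R - c * f = e * (R + c * r) := by rw [hRr]; ring
    rw [this, hR, hr]; field_simp; ring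
  have hL0 : (h + d) * T - d * f ≠ 0 := by
    rw [hL]
    exact mul_ne_zero hh (mul_ne_zero (div_ne_zero (mul_ne_zero hd zy) (mul_ne_zero xz z0)) x0)
  have hM0 : (e + c + f) * T + d * f ≠ 0 := by
    intro h0
    have h2 : (e + c) * R - c * f = -c * ((e + c + f) * T + d * f) / (T + d) := by
      rw [hRT]; field_simp; ring
    rw [h0, mul_zero, zero_div, hM1] at h2
    exact mul_ne_zero he (mul_ne_zero (div_ne_zero (mul_ne_zero hc yz)
      (mul_ne_zero xy y1)) x1) h2
  have hsum : a / x + b / (x - 1) + e / (y - 1) + h / z = 0 := by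
    linear_combination e1 + e2 + e3
  have key := reduced_equation habcd hc T0 Td hL0 hM0 hRT
  have hlhs : a * (T - f) * T / ((h + d) * T - d * f) - b * (R - f) * R / ((e + c) * R - c * f)
      - R + T = (z - y) * (a / x + b / (x - 1) + e / (y - 1) + h / z) := by
    have h1 : T - f = h * t := by rw [hTt]; ring
    have h2 : R - f = e * r := by rw [hRr]; ring
    have h3 : -R + T = -(e * r) + h * t := by rw [hTt, hRr]; ring
    have h4 : a * (T - f) * T / ((h + d) * T - d * f) = (z - y) * (a / x) := by
      rw [h1, hL, hT, ht]; field_simp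
    have h5 : b * (R - f) * R / ((e + c) * R - c * f) = -((z - y) * (b / (x - 1))) := by
      rw [h2, hM1, hR, hr]; field_simp; ring
    have h6 : -(e * r) + h * t = (z - y) * (e / (y - 1) + h / z) := by
      rw [hr, ht]; field_simp; ring
    rw [h4, h5]
    linear_combination h3 + h6
  rw [hlhs, hsum, mul_zero] at key
  have hquad := (div_eq_zero_iff.1 key.symm).resolve_right
    (mul_ne_zero (mul_ne_zero Td hL0) hM0)
  have htT : tOf f h T = t := by unfold tOf; rw [hTt]; field_simp; ring
  have hrT : rOf c d e f T = r := by unfold rOf; rw [← hRT, hRr]; field_simp; ring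
  have hD : r + t - r * t = (y - z) / (z * (y - 1)) := by
    rw [hr, ht]; field_simp; ring
  have hz : z = zOf c d e f h T := by
    unfold zOf
    rw [htT, hrT, hD, hr]
    field_simp
  refine ⟨T, (mul_eq_zero.1 hquad).resolve_left (pow_ne_zero 2 T0), ?_, ?_, hz⟩
  · unfold xOf
    rw [← hz, htT, hT, ht]; field_simp; ring
  · unfold yOf
    rw [← hz, htT, ht]; field_simp; ring

lemma octCrit_of_root {K : Type*} [Field K] {a b c d e f h T : K}
    (habcd : a + b + c + d = 0) (hN : Nondegenerate c d e f h T)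
    (hT : quadA a c d e f h * (T * T) + quadB a b c d e f h * T + quadC a b c d e f h = 0) :
    OctDom (xOf c d e f h T) (yOf c d e f h T) (zOf c d e f h T) ∧
      OctCrit a b c d e f h (xOf c d e f h T) (yOf c d e f h T) (zOf c d e f h T) ∧
      T = d * (zOf c d e f h T - yOf c d e f h T) / (xOf c d e f h T - zOf c d e f h T) := by
  obtain ⟨hc, hd, he, hh, T0, Td, Tf, t1, hL0, hM0, r1, r0, D0⟩ := hN
  obtain ⟨R, hR⟩ : ∃ R, R = -c * T / (T + d) := ⟨_, rfl⟩
  obtain ⟨t, ht⟩ : ∃ t, t = tOf f h T := ⟨_, rfl⟩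
  obtain ⟨r, hr⟩ : ∃ r, r = rOf c d e f T := ⟨_, rfl⟩
  obtain ⟨D, hD⟩ : ∃ D, D = r + t - r * t := ⟨_, rfl⟩
  obtain ⟨z, hz⟩ : ∃ z, z = zOf c d e f h T := ⟨_, rfl⟩
  obtain ⟨y, hy⟩ : ∃ y, y = yOf c d e f h T := ⟨_, rfl⟩
  obtain ⟨x, hx⟩ : ∃ x, x = xOf c d e f h T := ⟨_, rfl⟩
  have key := reduced_equation habcd hc T0 Td hL0 hM0 hR
  rw [hT, mul_zero, zero_div] at key
  rw [← hx, ← hy, ← hz]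
  have R0 : R ≠ 0 := by rw [hR]; exact div_ne_zero (mul_ne_zero (neg_ne_zero.2 hc) T0) Td
  have htT : T - f = h * t := by rw [ht]; unfold tOf; field_simp
  have hrR : R - f = e * r := by rw [hr]; unfold rOf; rw [← hR]; field_simp
  have t0 : t ≠ 0 := by rintro rfl; exact Tf (by rw [htT, mul_zero])
  have t1' : 1 - t ≠ 0 := fun h0 => t1 (by linear_combination h * h0 - htT)
  have hRT : R * (T + d) = -c * T := by rw [hR]; field_simp
  have hrr : e * (T + d) * r = -((c + f) * T + d * f) := by
    linear_combination hRT - (T + d) * hrR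
  have r0' : r ≠ 0 := by
    rintro rfl
    exact r0 (by linear_combination hrr)
  have r1' : 1 - r ≠ 0 := fun h0 => r1 (by linear_combination e * (T + d) * h0 + hrr)
  have hDD : h * e * (T + d) * D
      = e * (T - f) * (T + d) - ((c + f) * T + d * f) * (h + f - T) := by
    rw [hD]
    linear_combination (h * (1 - t)) * hrr - (e * (T + d) + ((c + f) * T + d * f)) * htT
  have hD0 : D ≠ 0 := by
    rintro rfl
    exact D0 (by rw [← hDD, mul_zero])
  have hLt : (h + d) * T - d * f = h * (T + d * t) := by linear_combination d * htT
  have hMr : (e + c) * R - c * f = e * (R + c * r) := by linear_combination c * hrR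
  have hL1 : T + d * t ≠ 0 := by
    intro h0; exact hL0 (by rw [hLt, h0, mul_zero])
  have hM2 : (T + d) * ((e + c) * R - c * f) = -c * ((e + c + f) * T + d * f) := by
    linear_combination (e + c) * hRT
  have hM1 : R + c * r ≠ 0 := by
    intro h0
    rw [hMr, h0, mul_zero, mul_zero] at hM2
    exact mul_ne_zero (neg_ne_zero.2 hc) hM0 hM2.symm
  have hz' : z = r / D := by rw [hz, zOf, ← hr, ← ht, ← hD]
  have hy' : y = z * (1 - t) := by rw [hy, yOf, ← ht, ← hz]
  have hx' : x = z * (T + d * t) / T := by rw [hx, xOf, ← ht, ← hz]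
  have hA : R * T + d * R + c * T = 0 := by linear_combination hRT
  have y1 : y - 1 = -t / D := by
    rw [hy', hz']; field_simp; rw [hD]; ring
  have z1 : z - 1 = -t * (1 - r) / D := by
    rw [hz']; field_simp; rw [hD]; ring
  have zy : z - y = r * t / D := by rw [hy', hz']; field_simp; ring
  have zx : z - x = -(d * r * t) / (T * D) := by rw [hx', hz']; field_simp; ring
  have yx : y - x = c * r * t / (R * D) := by
    have h1 : y - x = -(r * t / D) + -(d * r * t) / (T * D) := by
      linear_combination -zy + zx
    rw [h1]; field_simp; linear_combination -hA
  have x1 : x - 1 = -t * (R + c * r) / (R * D) := by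
    have h1 : x - 1 = -t / D - c * r * t / (R * D) := by linear_combination y1 - yx
    rw [h1]; field_simp; ring
  have x0 : x = r * (T + d * t) / (T * D) := by rw [hx', hz']; field_simp
  have y0 : y = r * (1 - t) / D := by rw [hy', hz']; field_simp
  have key' : a * T * t / (T + d * t) - b * R * r / (R + c * r) - R + T = 0 := by
    have h1 : a * (T - f) * T / ((h + d) * T - d * f) = a * T * t / (T + d * t) := by
      rw [hLt, htT]; field_simp
    have h2 : b * (R - f) * R / ((e + c) * R - c * f) = b * R * r / (R + c * r) := by
      rw [hMr, hrR]; field_simp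
    rw [← key, h1, h2]
  refine ⟨⟨?_, ?_, ?_, ?_, ?_, ?_, ?_, ?_, ?_⟩, ⟨?_, ?_, ?_⟩, ?_⟩
  · rw [x0]; exact div_ne_zero (mul_ne_zero r0' hL1) (mul_ne_zero T0 hD0)
  · rw [y0]; exact div_ne_zero (mul_ne_zero r0' t1') hD0
  · rw [hz']; exact div_ne_zero r0' hD0
  · rw [x1]; exact div_ne_zero (mul_ne_zero (neg_ne_zero.2 t0) hM1) (mul_ne_zero R0 hD0)
  · rw [y1]; exact div_ne_zero (neg_ne_zero.2 t0) hD0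
  · rw [z1]; exact div_ne_zero (mul_ne_zero (neg_ne_zero.2 t0) r1') hD0
  · rw [yx]; exact div_ne_zero (mul_ne_zero (mul_ne_zero hc r0') t0) (mul_ne_zero R0 hD0)
  · rw [zx]
    exact div_ne_zero (neg_ne_zero.2 (mul_ne_zero (mul_ne_zero hd r0') t0)) (mul_ne_zero T0 hD0)
  · rw [zy]; exact div_ne_zero (mul_ne_zero r0' t0) hD0
  · have h1 : a / x + b / (x - 1) - c / (y - x) - d / (z - x)
        = D / (r * t) * (a * T * t / (T + d * t) - b * R * r / (R + c * r) - R + T) := by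
      rw [x1, yx, zx, x0]; field_simp; ring
    rw [h1, key', mul_zero]
  · have h1 : e / (y - 1) + c / (y - x) - f / (z - y) = -(D / (r * t)) * (e * r - R + f) := by
      rw [y1, yx, zy]; field_simp; ring
    rw [h1, ← hrR]; ring
  · have h1 : h / z + d / (z - x) + f / (z - y) = D / (r * t) * (h * t - T + f) := by
      rw [zx, zy, hz']; field_simp; ring
    rw [h1, ← htT]; ring
  · have h1 : x - z = d * r * t / (T * D) := by rw [← neg_sub, zx]; ring
    rw [h1, zy]; field_simp

lemma mem_Udom_six_iff (x : Fin (6 - 3) → ℂ) :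
    x ∈ Udom 6 ↔ OctDom (x 0) (x 1) (x 2) := by
  have key : x ∈ Udom 6 ↔ ∀ i ∈ Finset.Icc 1 5, ∀ j ∈ Finset.Icc 1 5,
      i < j → (i, j) ≠ (1, 2) → pc 6 x i j ≠ 0 := by
    simp only [Udom, Sfin, Set.mem_ofPred_eq, Finset.mem_filter, Finset.mem_product, Prod.forall]
    exact ⟨fun H i hi j hj h1 h2 => H i j ⟨⟨hi, hj⟩, h1, h2⟩,
      fun H i j h => H i h.1.1 j h.1.2 h.2.1 h.2.2⟩
  have hI : Finset.Icc 1 5 = ({1, 2, 3, 4, 5} : Finset ℕ) := by decide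
  rw [key, hI]
  simp [pc, colA, colB]
  constructor
  · rintro ⟨⟨x0, y0, z0⟩, ⟨x1, y1, z1⟩, ⟨yx, zx⟩, zy⟩
    exact ⟨x0, y0, z0, x1, y1, z1, yx, zx, zy⟩
  · rintro ⟨x0, y0, z0, x1, y1, z1, yx, zx, zy⟩
    exact ⟨⟨x0, y0, z0⟩, ⟨x1, y1, z1⟩, ⟨yx, zx⟩, zy⟩

lemma isCrit_six_iff {s : ℕ × ℕ → ℂ} (hs : InV s) (x : Fin (6 - 3) → ℂ) :
    IsCrit 6 P6 s x ↔ OctCrit (s (1, 3)) (s (2, 3)) (s (3, 4)) (s (3, 5)) (s (2, 4)) (s (4, 5))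
      (s (1, 5)) (x 0) (x 1) (x 2) := by
  obtain ⟨-, h14, h25, -⟩ := hs
  have hI : Finset.Icc 1 6 = ({1, 2, 3, 4, 5, 6} : Finset ℕ) := by decide
  have hF : IsCrit 6 P6 s x ↔ ∀ m : Fin 3, ∑ e ∈ P6, s e * dpc 6 e.1 e.2 m / pc 6 x e.1 e.2 = 0 :=
    Iff.rfl
  rw [hF, Fin.forall_fin_succ, Fin.forall_fin_succ, Fin.forall_fin_one]
  simp [P6, hI, Finset.sum_filter, Finset.sum_product, dpc, pc, colA, colB, h14, h25, OctCrit]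
  simp only [neg_div, sub_eq_add_neg, add_assoc]

lemma InV.sum_vertex_three {s : ℕ × ℕ → ℂ} (hs : InV s) :
    s (1, 3) + s (2, 3) + s (3, 4) + s (3, 5) = 0 := by
  obtain ⟨h, -, -, h36⟩ := hs
  have hI : Finset.Icc 1 6 = ({1, 2, 3, 4, 5, 6} : Finset ℕ) := by decide
  have := h 3 (by decide)
  simp [hI, sext, h36] at this
  linear_combination this

/-- A point of the kinematic space at which `genericity` does not vanish. -/
def sampleKinematics (p : ℕ × ℕ) : ℂ :=
  if p ∈ [(1, 2), (1, 3), (4, 6), (5, 6)] then -3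
  else if p = (1, 6) then 5
  else if p ∈ [(1, 4), (2, 5), (3, 6)] then 0
  else 1

lemma inV_sampleKinematics : InV sampleKinematics := by
  have hI : Finset.Icc 1 6 = ({1, 2, 3, 4, 5, 6} : Finset ℕ) := by decide
  simp [InV, hI, sext, sampleKinematics]
  norm_num

/-- The critical point with parameter `T`. -/
def octPoint (c d e f h T : ℂ) (i : Fin (6 - 3)) : ℂ :=
  match (i : ℕ) with
  | 0 => xOf c d e f h T
  | 1 => yOf c d e f h T
  | _ => zOf c d e f h T

lemma exists_two_roots {A B C : ℂ} (hA : A ≠ 0) (hdisc : B * B - 4 * A * C ≠ 0) :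
    ∃ T₁ T₂ : ℂ, T₁ ≠ T₂ ∧ ∀ T, A * (T * T) + B * T + C = 0 ↔ T = T₁ ∨ T = T₂ := by
  obtain ⟨w, hw⟩ := IsAlgClosed.exists_pow_nat_eq (B * B - 4 * A * C) (n := 2) two_pos
  have hw0 : w ≠ 0 := by
    rintro rfl
    exact hdisc (by rw [← hw]; simp)
  refine ⟨(-B + w) / (2 * A), (-B - w) / (2 * A), ?_, fun T =>
    quadratic_eq_zero_iff hA (by rw [discrim]; linear_combination -hw) T⟩
  intro h
  rw [div_left_inj' (mul_ne_zero two_ne_zero hA)] at h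
  exact hw0 (by linear_combination h / 2)

/-- the octahedral hypertree has maximum likelihood degree 2:
for generic s in V the restricted scattering potential has exactly two
critical points in U. -/
theorem octahedral_hypertree_ML_degree_two :
    ∃ g : MvPolynomial (ℕ × ℕ) ℂ,
      (∃ s₀ : ℕ × ℕ → ℂ, InV s₀ ∧ MvPolynomial.eval s₀ g ≠ 0) ∧
      ∀ s : ℕ × ℕ → ℂ, InV s → MvPolynomial.eval s g ≠ 0 →
        {x : Fin (6 - 3) → ℂ | x ∈ Udom 6 ∧ IsCrit 6 P6 s x}.Finite ∧
        {x : Fin (6 - 3) → ℂ | x ∈ Udom 6 ∧ IsCrit 6 P6 s x}.ncard = 2 := by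
  obtain ⟨g, hg⟩ : ∃ g : MvPolynomial (ℕ × ℕ) ℂ, ∀ s, MvPolynomial.eval s g
      = genericity (s (1, 3)) (s (2, 3)) (s (3, 4)) (s (3, 5)) (s (2, 4)) (s (4, 5)) (s (1, 5)) :=
    ⟨genericity (.X (1, 3)) (.X (2, 3)) (.X (3, 4)) (.X (3, 5)) (.X (2, 4)) (.X (4, 5))
      (.X (1, 5)), fun s => by simp [map_genericity]⟩
  refine ⟨g, ⟨sampleKinematics, inV_sampleKinematics, ?_⟩, ?_⟩
  · rw [hg]
    norm_num [sampleKinematics, genericity, genericityAux, quadA, quadB, quadC, linRes, quadRes]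
  intro s hs hne
  rw [hg] at hne
  have hsum := hs.sum_vertex_three
  have hcrit := isCrit_six_iff hs
  generalize s (1, 3) = a at *
  generalize s (2, 3) = b at *
  generalize s (3, 4) = c at *
  generalize s (3, 5) = d at *
  generalize s (2, 4) = e at *
  generalize s (4, 5) = f at *
  generalize s (1, 5) = h at *
  have hne' := hne
  simp only [genericity, genericityAux, mul_ne_zero_iff] at hne'
  obtain ⟨⟨⟨⟨⟨⟨⟨⟨⟨⟨⟨⟨⟨⟨hc, hd⟩, he⟩, hh⟩, hA⟩, hdisc⟩, -⟩, -⟩, -⟩, -⟩, -⟩, -⟩, -⟩, -⟩, -⟩ := hne'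
  obtain ⟨T₁, T₂, hT₁₂, hroots⟩ := exists_two_roots (B := quadB a b c d e f h) hA hdisc
  have hback := fun T (hT : T = T₁ ∨ T = T₂) => octCrit_of_root hsum
    (nondegenerate_of_genericity_ne_zero hne ((hroots T).2 hT)) ((hroots T).2 hT)
  have hset : {x : Fin (6 - 3) → ℂ | x ∈ Udom 6 ∧ IsCrit 6 P6 s x} = {octPoint c d e f h T₁, octPoint c d e f h T₂} := by
    ext x
    simp only [Set.mem_ofPred_eq, Set.mem_insert_iff, Set.mem_singleton_iff]
    rw [mem_Udom_six_iff, hcrit]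
    constructor
    · rintro ⟨hU, hx⟩
      obtain ⟨T, hT, h0, h1, h2⟩ := eq_of_octCrit hsum hc hd he hh hU hx
      have hx : x = octPoint c d e f h T := by
        funext ⟨i, hi⟩
        interval_cases i
        exacts [h0, h1, h2]
      rcases (hroots T).1 hT with rfl | rfl
      exacts [Or.inl hx, Or.inr hx]
    · rintro (rfl | rfl)
      exacts [⟨(hback _ (Or.inl rfl)).1, (hback _ (Or.inl rfl)).2.1⟩,
        ⟨(hback _ (Or.inr rfl)).1, (hback _ (Or.inr rfl)).2.1⟩]
  have hpoints : octPoint c d e f h T₁ ≠ octPoint c d e f h T₂ := by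
    intro heq
    have h0 : xOf c d e f h T₁ = xOf c d e f h T₂ := congrFun heq 0
    have h1 : yOf c d e f h T₁ = yOf c d e f h T₂ := congrFun heq 1
    have h2 : zOf c d e f h T₁ = zOf c d e f h T₂ := congrFun heq 2
    apply hT₁₂
    rw [(hback T₁ (Or.inl rfl)).2.2, (hback T₂ (Or.inr rfl)).2.2, h0, h1, h2]
  rw [hset]
  exact ⟨Set.toFinite _, Set.ncard_pair hpoints⟩

end
end MinKin
end
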